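/- arXiv:1801.07025 — 2 statements merged into one kernel-verified Lean document; each statement's English description precedes it below -/
import Mathlib

section
/- There exists a natural number d such that every finite simple connected graph with minimum degree at least d has a spanning tree T in which no two vertices of degree 2 (in T) are adjacent (in T). -/
open SimpleGraph

/-- The degree of a vertex `v` in a simple graph `H`. -/
noncomputable def gdeg {V : Type} (H : SimpleGraph V) (v : V) : ℕ :=
  Nat.card (H.neighborSet v)


open Classical in
lemma exists_idx {V : Type} (s : Finset V) :
    ∃ f : V → ℕ, (∀ a ∈ s, ∀ b ∈ s, f a = f b → a = b) ∧ ∀ b ∈ s, f b < s.card := by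
  refine ⟨fun b => if h : b ∈ s then (s.equivFin ⟨b, h⟩).val else 0, ?_, ?_⟩
  · intro a ha b hb h
    simp only [ha, hb, dif_pos] at h
    have := s.equivFin.injective (Fin.ext h)
    simpa using this
  · intro b hb
    simp only [hb, dif_pos]
    exact (s.equivFin ⟨b, hb⟩).isLt

open Classical in
/-- Hall-type lemma: private neighbours which use at most half of every class of `c`. -/
lemma steal {V : Type} (A B : Finset V) (R : V → V → Prop) (c : V → V) (k m : ℕ)
    (hm : 0 < m)
    (h1 : ∀ a ∈ A, 2 * m * k ≤ (B.filter (fun b => R a b)).card)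
    (h2 : ∀ b ∈ B, (A.filter (fun a => R a b)).card ≤ m) :
    ∃ g : V → Fin k → V, (∀ a ∈ A, ∀ i, g a i ∈ B ∧ R a (g a i)) ∧
      (∀ a ∈ A, ∀ a' ∈ A, ∀ i j, g a i = g a' j → a = a' ∧ i = j) ∧
      ∀ γ, 2 * (B.filter (fun b => c b = γ ∧ ∃ a ∈ A, ∃ i, g a i = b)).card
        ≤ (B.filter (fun b => c b = γ)).card + 1 := by
  choose F hF1 hF2 using (fun s : Finset V => exists_idx s)
  let fib : V → Finset V := fun γ => B.filter (fun b => c b = γ)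
  let idx : V → ℕ := fun b => F (fib (c b)) b
  let slot : V → V × ℕ := fun b => (c b, idx b / 2)
  have hidx : ∀ a ∈ B, ∀ b ∈ B, c a = c b → idx a = idx b → a = b := by
    intro a ha b hb hc hi
    have : fib (c a) = fib (c b) := by rw [hc]
    apply hF1 (fib (c b)) a (by simp [fib, ha, hc]) b (by simp [fib, hb])
    simpa [idx, this] using hi
  have hfib : ∀ (N : Finset V), N ⊆ B → N.card ≤ 2 * (N.image slot).card := by
    intro N hN
    apply Finset.card_le_mul_card_image
    rintro ⟨γ, q⟩ _
    calc _ ≤ ({2*q, 2*q+1} : Finset ℕ).card := by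
          apply Finset.card_le_card_of_injOn idx
          · intro b hb
            simp [slot] at hb
            simp; omega
          · intro a ha b hb hab
            simp [slot] at ha hb
            exact hidx a (hN ha.1) b (hN hb.1) (by rw [ha.2.1, hb.2.1]) hab
      _ ≤ 2 := Finset.card_le_two
  let ι := {x : V × Fin k // x.1 ∈ A}
  let t : ι → Finset (V × ℕ) := fun x => (B.filter (fun b => R x.1.1 b)).image slot
  have hall : ∀ S : Finset ι, S.card ≤ (S.biUnion t).card := by
    intro S
    let A' : Finset V := S.image (fun x => x.1.1)
    have hA' : ∀ a ∈ A', a ∈ A := by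
      intro a ha
      simp only [A', Finset.mem_image] at ha
      obtain ⟨x, _, rfl⟩ := ha
      exact x.2
    let N : Finset V := A'.biUnion (fun a => B.filter (fun b => R a b))
    have e1 : S.biUnion t = N.image slot := by
      ext y
      simp only [t, N, A', Finset.mem_biUnion, Finset.mem_image]
      constructor
      · rintro ⟨x, hx, b, hb, rfl⟩
        exact ⟨b, ⟨x.1.1, ⟨x, hx, rfl⟩, hb⟩, rfl⟩
      · rintro ⟨b, ⟨a, ⟨x, hx, rfl⟩, hb⟩, rfl⟩
        exact ⟨x, hx, b, hb, rfl⟩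
    have hNB : N ⊆ B := by
      intro b hb
      simp only [N, Finset.mem_biUnion, Finset.mem_filter] at hb
      obtain ⟨_, _, h, _⟩ := hb
      exact h
    have e2 := hfib N hNB
    have e3 : A'.card * (2 * m * k) ≤ N.card * m := by
      apply Finset.card_mul_le_card_mul R
      · intro a ha
        refine (h1 a (hA' a ha)).trans (Finset.card_le_card ?_)
        intro b hb
        simp only [Finset.mem_filter] at hb
        simp only [Finset.mem_bipartiteAbove, N, Finset.mem_biUnion, Finset.mem_filter]
        exact ⟨⟨a, ha, hb⟩, hb.2⟩
      · intro b hb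
        refine le_trans (Finset.card_le_card ?_) (h2 b (hNB hb))
        intro a ha
        simp only [Finset.mem_bipartiteBelow] at ha
        simp only [Finset.mem_filter]
        exact ⟨hA' a ha.1, ha.2⟩
    have e4 : S.card ≤ A'.card * k := by
      have : S.card ≤ (A' ×ˢ (Finset.univ : Finset (Fin k))).card := by
        apply Finset.card_le_card_of_injOn (fun x => x.1)
        · intro x hx
          have : x.1.1 ∈ A' := Finset.mem_image.2 ⟨x, hx, rfl⟩
          simp [this]
        · intro x _ y _ h
          exact Subtype.ext h
      simpa using this
    rw [e1]
    have e5 : (A'.card * k * 2) * m ≤ N.card * m := by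
      calc _ = A'.card * (2 * m * k) := by ring
        _ ≤ _ := e3
    have e6 := Nat.le_of_mul_le_mul_right e5 hm
    omega
  obtain ⟨f, hf1, hf2⟩ := (Finset.all_card_le_biUnion_card_iff_exists_injective t).1 hall
  have hb : ∀ x : ι, ∃ b, b ∈ B ∧ R x.1.1 b ∧ slot b = f x := by
    intro x
    have := hf2 x
    simp only [t, Finset.mem_image, Finset.mem_filter] at this
    obtain ⟨b, hb, h⟩ := this
    exact ⟨b, hb.1, hb.2, h⟩
  choose b hb1 hb2 hb3 using hb
  let g : V → Fin k → V := fun a i => if h : a ∈ A then b ⟨(a, i), h⟩ else a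
  have hg : ∀ a (h : a ∈ A) i, g a i = b ⟨(a, i), h⟩ := by
    intro a h i; simp [g, h]
  have key : ∀ a ∈ A, ∀ a' ∈ A, ∀ i j, slot (g a i) = slot (g a' j) → a = a' ∧ i = j := by
    intro a ha a' ha' i j h
    rw [hg a ha, hg a' ha', hb3, hb3] at h
    have := congrArg Subtype.val (hf1 h)
    simpa using this
  refine ⟨g, ?_, ?_, ?_⟩
  · intro a ha i
    rw [hg a ha]
    exact ⟨hb1 _, hb2 ⟨(a, i), ha⟩⟩
  · intro a ha a' ha' i j h
    exact key a ha a' ha' i j (by rw [h])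
  · intro γ
    have : (B.filter (fun b => c b = γ ∧ ∃ a ∈ A, ∃ i, g a i = b)).card
        ≤ (Finset.range (((fib γ).card + 1) / 2)).card := by
      apply Finset.card_le_card_of_injOn (fun b => idx b / 2)
      · intro b hb
        simp only [Finset.coe_filter, Set.mem_ofPred_eq] at hb
        have h := hF2 (fib γ) b (by simp [fib, hb.1, hb.2.1])
        have h' : idx b = F (fib γ) b := by simp [idx, hb.2.1]
        simp only [Finset.coe_range, Set.mem_Iio]
        omega
      · intro b hb b' hb' h
        simp only [Finset.coe_filter, Set.mem_ofPred_eq] at hb hb'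
        obtain ⟨hbB, hbc, a, ha, i, rfl⟩ := hb
        obtain ⟨hbB', hbc', a', ha', i', rfl⟩ := hb'
        obtain ⟨rfl, rfl⟩ := key a ha a' ha' i i' (by
          simp only [slot]; rw [hbc, hbc']; simpa using h)
        rfl
    rw [Finset.card_range] at this
    simp only [fib] at this
    omega

/-- A packing of stars with at least `K` leaves: centres `C`, leaves `L`, leaf-to-centre map `f`. -/
def Pack {V : Type} [DecidableEq V] (G : SimpleGraph V) (K : ℕ) (C L : Finset V) (f : V → V) :
    Prop :=
  Disjoint C L ∧ (∀ v ∈ L, f v ∈ C ∧ G.Adj v (f v)) ∧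
    ∀ c ∈ C, K ≤ (L.filter (fun v => f v = c)).card

open Classical in
lemma star_factor {V : Type} [Fintype V] (G : SimpleGraph V) (k : ℕ) (hk : 1 ≤ k)
    (hd : ∀ v, 4 * k * k + 2 * k ≤ (Finset.univ.filter (fun w => G.Adj v w)).card) :
    ∃ (C : Finset V) (f : V → V), (∀ v, v ∉ C → f v ∈ C ∧ G.Adj v (f v)) ∧
      ∀ c ∈ C, k ≤ (Finset.univ.filter (fun v => v ∉ C ∧ f v = c)).card := by
  obtain ⟨⟨C, L, f⟩, hmem, hmax⟩ := Finset.exists_max_image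
    ((Finset.univ : Finset (Finset V × Finset V × (V → V))).filter
      (fun x => Pack G (2 * k) x.1 x.2.1 x.2.2)) (fun x => x.1.card + x.2.1.card)
    ⟨(∅, ∅, id), Finset.mem_filter.2 ⟨Finset.mem_univ _, by simp [Pack]⟩⟩
  simp only [Finset.mem_filter, Finset.mem_univ, true_and] at hmem hmax
  have hmax' : ∀ C' L' f', Pack G (2 * k) C' L' f' → C'.card + L'.card ≤ C.card + L.card :=
    fun C' L' f' h => hmax (C', L', f') h
  obtain ⟨hdis, hL, hK⟩ := hmem
  have hCL : ∀ v, v ∈ C → v ∉ L := fun v h => Finset.disjoint_left.1 hdis h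
  let U : Finset V := Finset.univ.filter (fun v => v ∉ C ∧ v ∉ L)
  have hU : ∀ v, v ∈ U ↔ v ∉ C ∧ v ∉ L := by simp [U]
  -- uncovered vertices see no centres
  have ha : ∀ v ∈ U, ∀ c ∈ C, ¬ G.Adj v c := by
    intro v hv c hc hadj
    obtain ⟨hv1, hv2⟩ := (hU v).1 hv
    have := hmax' C (insert v L) (Function.update f v c) ⟨?_, ?_, ?_⟩
    · rw [Finset.card_insert_of_notMem hv2] at this; omega
    · rw [Finset.disjoint_insert_right]; exact ⟨hv1, hdis⟩
    · intro w hw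
      by_cases h : w = v
      · subst h; simpa using ⟨hc, hadj⟩
      · simp only [Function.update_of_ne h]
        exact hL w (by simpa [h] using hw)
    · intro c' hc'
      refine (hK c' hc').trans (Finset.card_le_card ?_)
      intro w hw
      simp only [Finset.mem_filter, Finset.mem_insert] at hw ⊢
      have h : w ≠ v := by rintro rfl; exact hv2 hw.1
      simp only [Function.update_of_ne h]
      exact ⟨Or.inr hw.1, hw.2⟩
  -- no vertex outside `C` sees many uncovered vertices
  have hb : ∀ z, z ∉ C → (U.filter (fun u => G.Adj z u)).card ≤ 2 * k := by
    intro z hz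
    by_contra hcon
    push Not at hcon
    set N := U.filter (fun u => G.Adj z u) with hN
    have hNU : ∀ u ∈ N, u ∉ C ∧ u ∉ L ∧ G.Adj z u := by
      intro u hu
      simp only [hN, Finset.mem_filter, hU] at hu
      tauto
    have hzN : z ∉ N := fun h => G.loopless.irrefl z (hNU z h).2.2
    let f' : V → V := fun v => if v ∈ N then z else f v
    have hf'N : ∀ v ∈ N, f' v = z := by intro v hv; simp [f', hv]
    have hf'n : ∀ v, v ∉ N → f' v = f v := by intro v hv; simp [f', hv]
    by_cases hcase : z ∉ L ∨ 2 * k + 1 ≤ (L.filter (fun v => f v = f z)).card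
    · have := hmax' (insert z C) (L.erase z ∪ N) f' ⟨?_, ?_, ?_⟩
      · rw [Finset.card_insert_of_notMem hz, Finset.card_union_of_disjoint] at this
        · have h2 := Finset.pred_card_le_card_erase (s := L) (a := z)
          omega
        · rw [Finset.disjoint_left]
          intro a ha1 ha2
          exact (hNU a ha2).2.1 (Finset.mem_of_mem_erase ha1)
      · rw [Finset.disjoint_left]
        intro a ha1 ha2
        simp only [Finset.mem_insert, Finset.mem_union, Finset.mem_erase] at ha1 ha2
        rcases ha1 with rfl | ha1
        · tauto
        · rcases ha2 with ha2 | ha2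
          · exact hCL a ha1 ha2.2
          · exact (hNU a ha2).1 ha1
      · intro v hv
        by_cases hvN : v ∈ N
        · rw [hf'N v hvN]
          exact ⟨by simp, (hNU v hvN).2.2.symm⟩
        · rw [hf'n v hvN]
          simp only [Finset.mem_union, Finset.mem_erase] at hv
          have := hL v (by tauto)
          exact ⟨by simp [this.1], this.2⟩
      · intro c hc
        rw [Finset.mem_insert] at hc
        rcases hc with rfl | hc
        · refine le_trans (le_of_lt hcon) (Finset.card_le_card ?_)
          intro v hv
          simp only [Finset.mem_filter, Finset.mem_union]
          exact ⟨Or.inr hv, hf'N v hv⟩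
        · have hsub : (L.filter (fun v => f v = c)).erase z ⊆
              (L.erase z ∪ N).filter (fun v => f' v = c) := by
            intro v hv
            simp only [Finset.mem_erase, Finset.mem_filter, Finset.mem_union] at hv ⊢
            have hvN : v ∉ N := fun h => (hNU v h).2.1 hv.2.1
            rw [hf'n v hvN]
            tauto
          refine le_trans ?_ (Finset.card_le_card hsub)
          by_cases hzc : z ∈ L.filter (fun v => f v = c)
          · rw [Finset.card_erase_of_mem hzc]
            simp only [Finset.mem_filter] at hzc
            rcases hcase with h | h
            · exact absurd hzc.1 h
            · rw [hzc.2] at h; omega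
          · rw [Finset.erase_eq_of_notMem hzc]
            exact hK c hc
    · push Not at hcase
      obtain ⟨hzL, hsm⟩ := hcase
      set c := f z with hc
      have hcC : c ∈ C := (hL z hzL).1
      set S := L.filter (fun v => f v = c) with hS
      have hSL : S ⊆ L := Finset.filter_subset _ _
      have hzS : z ∈ S := by simp [hS, hzL, hc]
      have hzc : z ∉ C.erase c := fun h => hz (Finset.mem_of_mem_erase h)
      have := hmax' (insert z (C.erase c)) (L \ S ∪ N) f' ⟨?_, ?_, ?_⟩
      · rw [Finset.card_insert_of_notMem hzc, Finset.card_erase_of_mem hcC,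
          Finset.card_union_of_disjoint, Finset.card_sdiff_of_subset hSL] at this
        · have h1 := Finset.card_pos.2 ⟨c, hcC⟩
          have h2 := Finset.card_le_card hSL
          omega
        · rw [Finset.disjoint_left]
          intro a ha1 ha2
          exact (hNU a ha2).2.1 (Finset.mem_sdiff.1 ha1).1
      · rw [Finset.disjoint_left]
        intro a ha1 ha2
        simp only [Finset.mem_insert, Finset.mem_union, Finset.mem_erase, Finset.mem_sdiff]
          at ha1 ha2
        rcases ha1 with rfl | ha1
        · tauto
        · rcases ha2 with ha2 | ha2
          · exact hCL a ha1.2 ha2.1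
          · exact (hNU a ha2).1 ha1.2
      · intro v hv
        by_cases hvN : v ∈ N
        · rw [hf'N v hvN]
          exact ⟨by simp, (hNU v hvN).2.2.symm⟩
        · rw [hf'n v hvN]
          simp only [Finset.mem_union, Finset.mem_sdiff, hS, Finset.mem_filter] at hv
          have h3 : v ∈ L ∧ f v ≠ c := by tauto
          have := hL v h3.1
          exact ⟨by simp [this.1, h3.2], this.2⟩
      · intro c' hc'
        rw [Finset.mem_insert] at hc'
        rcases hc' with rfl | hc'
        · refine le_trans (le_of_lt hcon) (Finset.card_le_card ?_)
          intro v hv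
          simp only [Finset.mem_filter, Finset.mem_union]
          exact ⟨Or.inr hv, hf'N v hv⟩
        · rw [Finset.mem_erase] at hc'
          refine (hK c' hc'.2).trans (Finset.card_le_card ?_)
          intro v hv
          simp only [Finset.mem_filter, Finset.mem_union, Finset.mem_sdiff, hS] at hv ⊢
          have hvN : v ∉ N := fun h => (hNU v h).2.1 hv.1
          rw [hf'n v hvN]
          refine ⟨Or.inl ⟨hv.1, ?_⟩, hv.2⟩
          rintro ⟨_, h⟩
          exact hc'.1 (hv.2 ▸ h)
  -- the uncovered vertices become centres
  obtain ⟨g, hg1, hg2, hg3⟩ := steal U L (fun u l => G.Adj u l) f k (2 * k) (by omega) (by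
      intro u hu
      have h1 := hd u
      have h2 := hb u ((hU u).1 hu).1
      have h3 : (Finset.univ.filter (fun w => G.Adj u w)) ⊆
          U.filter (fun w => G.Adj u w) ∪ L.filter (fun w => G.Adj u w) := by
        intro w hw
        simp only [Finset.mem_filter, Finset.mem_univ, true_and, Finset.mem_union] at hw ⊢
        have hwC : w ∉ C := fun h => ha u hu w h hw
        by_cases hwL : w ∈ L
        · exact Or.inr ⟨hwL, hw⟩
        · exact Or.inl ⟨(hU w).2 ⟨hwC, hwL⟩, hw⟩
      have h4 := (Finset.card_le_card h3).trans (Finset.card_union_le _ _)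
      have h5 : 2 * (2 * k) * k = 4 * k * k := by ring
      omega) (by
      intro b hbL
      have := hb b (fun h => hCL b h hbL)
      simpa only [G.adj_comm b] using this)
  let St : V → Prop := fun v => ∃ u ∈ U, ∃ i, g u i = v
  have hStL : ∀ v, St v → v ∈ L := by
    rintro v ⟨u, hu, i, rfl⟩
    exact (hg1 u hu i).1
  let f' : V → V := fun v => if h : St v then h.choose else f v
  have hf'S : ∀ u ∈ U, ∀ i, f' (g u i) = u := by
    intro u hu i
    have h : St (g u i) := ⟨u, hu, i, rfl⟩
    have h1 : f' (g u i) = h.choose := by simp only [f', dif_pos h]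
    have h2 := h.choose_spec
    obtain ⟨hu', j, hj⟩ := h2
    rw [h1]
    exact (hg2 _ hu' u hu j i hj).1
  have hf'n : ∀ v, ¬ St v → f' v = f v := by
    intro v h; simp only [f', dif_neg h]
  refine ⟨C ∪ U, f', ?_, ?_⟩
  · intro v hv
    simp only [Finset.mem_union, hU, not_or, not_and, not_not] at hv
    have hvL : v ∈ L := hv.2 hv.1
    by_cases hs : St v
    · obtain ⟨u, hu, i, rfl⟩ := hs
      rw [hf'S u hu i]
      exact ⟨Finset.mem_union_right _ hu, (hg1 u hu i).2.symm⟩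
    · rw [hf'n v hs]
      exact ⟨Finset.mem_union_left _ (hL v hvL).1, (hL v hvL).2⟩
  · have hLC : ∀ v ∈ L, v ∉ C ∪ U := by
      intro v hv h
      simp only [Finset.mem_union, hU] at h
      rcases h with h | h
      · exact hCL v h hv
      · exact h.2 hv
    intro c hc
    rw [Finset.mem_union] at hc
    rcases hc with hc | hc
    · have h1 := hK c hc
      have h2 := hg3 c
      have h3 : L.filter (fun v => f v = c) ⊆
          (Finset.univ.filter (fun v => v ∉ C ∪ U ∧ f' v = c)) ∪
          L.filter (fun b => f b = c ∧ ∃ a ∈ U, ∃ i, g a i = b) := by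
        intro v hv
        rw [Finset.mem_filter] at hv
        rw [Finset.mem_union]
        by_cases hs : St v
        · right
          rw [Finset.mem_filter]
          exact ⟨hv.1, hv.2, hs⟩
        · left
          rw [Finset.mem_filter]
          exact ⟨Finset.mem_univ _, hLC v hv.1, by rw [hf'n v hs]; exact hv.2⟩
      have h4 := (Finset.card_le_card h3).trans (Finset.card_union_le _ _)
      omega
    · have : (Finset.univ : Finset (Fin k)).card ≤
          (Finset.univ.filter (fun v => v ∉ C ∪ U ∧ f' v = c)).card := by
        apply Finset.card_le_card_of_injOn (fun i => g c i)
        · intro i _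
          rw [Finset.mem_coe, Finset.mem_filter]
          exact ⟨Finset.mem_univ _, hLC _ (hg1 c hc i).1, hf'S c hc i⟩
        · intro i _ j _ h
          exact (hg2 c hc c hc i j h).2
      simpa using this

/-- `T` with the edge `ab` removed. -/
def cutE {V : Type} (T : SimpleGraph V) (a b : V) : SimpleGraph V where
  Adj s t := T.Adj s t ∧ ¬(s = a ∧ t = b) ∧ ¬(s = b ∧ t = a)
  symm := ⟨fun _ _ h => ⟨h.1.symm, fun h' => h.2.2 ⟨h'.2, h'.1⟩, fun h' => h.2.1 ⟨h'.2, h'.1⟩⟩⟩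
  loopless := ⟨fun _ h => h.1.ne rfl⟩

/-- `T` with the edge `ab` removed and the edge `uv` added. -/
def swE {V : Type} (T : SimpleGraph V) (a b u v : V) : SimpleGraph V where
  Adj s t := (T.Adj s t ∧ ¬(s = a ∧ t = b) ∧ ¬(s = b ∧ t = a)) ∨
    (u ≠ v ∧ ((s = u ∧ t = v) ∨ (s = v ∧ t = u)))
  symm := ⟨by
    rintro s t (h | ⟨h, h'⟩)
    · exact Or.inl ⟨h.1.symm, fun h' => h.2.2 ⟨h'.2, h'.1⟩, fun h' => h.2.1 ⟨h'.2, h'.1⟩⟩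
    · exact Or.inr ⟨h, by tauto⟩⟩
  loopless := ⟨by
    rintro s (h | ⟨h, h'⟩)
    · exact h.1.ne rfl
    · rcases h' with h' | h'
      · exact h (h'.1.symm.trans h'.2)
      · exact h (h'.2.symm.trans h'.1)⟩

lemma cutE_adj {V : Type} (T : SimpleGraph V) (a b s t : V) : (cutE T a b).Adj s t ↔
    T.Adj s t ∧ ¬(s = a ∧ t = b) ∧ ¬(s = b ∧ t = a) := Iff.rfl

lemma swE_adj {V : Type} (T : SimpleGraph V) (a b u v s t : V) : (swE T a b u v).Adj s t ↔
    (T.Adj s t ∧ ¬(s = a ∧ t = b) ∧ ¬(s = b ∧ t = a)) ∨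
    (u ≠ v ∧ ((s = u ∧ t = v) ∨ (s = v ∧ t = u))) := Iff.rfl

lemma cutE_le_swE {V : Type} (T : SimpleGraph V) (a b u v : V) : cutE T a b ≤ swE T a b u v :=
  fun _ _ h => Or.inl h

lemma reach_of_adj {V : Type} {T H : SimpleGraph V} (h : ∀ s t, T.Adj s t → H.Reachable s t)
    {s t : V} (hr : T.Reachable s t) : H.Reachable s t := by
  obtain ⟨w⟩ := hr
  induction w with
  | nil => exact Reachable.refl _
  | cons hadj _ ih => exact (h _ _ hadj).trans ih

lemma swE_tree {V : Type} [Fintype V] {T : SimpleGraph V} (hT : T.IsTree) {a b u v : V}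
    (hab : T.Adj a b) (huv : ¬ T.Adj u v) (hne : u ≠ v)
    (h1 : (cutE T a b).Reachable a v) (h2 : (cutE T a b).Reachable b u) :
    (swE T a b u v).IsTree := by
  rw [isTree_iff_connected_and_card] at hT ⊢
  have hle := cutE_le_swE T a b u v
  have huv' : (swE T a b u v).Adj u v := Or.inr ⟨hne, Or.inl ⟨rfl, rfl⟩⟩
  have hab' : (swE T a b u v).Reachable a b :=
    ((h1.mono hle).trans huv'.symm.reachable).trans (h2.mono hle).symm
  constructor
  · have := hT.1.nonempty
    refine Connected.mk fun s t => ?_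
    refine reach_of_adj (T := T) ?_ (hT.1 s t)
    intro s t hst
    by_cases hc1 : s = a ∧ t = b
    · rw [hc1.1, hc1.2]; exact hab'
    by_cases hc2 : s = b ∧ t = a
    · rw [hc2.1, hc2.2]; exact hab'.symm
    exact Adj.reachable (Or.inl ⟨hst, hc1, hc2⟩)
  · have : (swE T a b u v).edgeSet = insert s(u, v) (T.edgeSet \ {s(a, b)}) := by
      ext e
      induction e with
      | h s t =>
        simp only [mem_edgeSet, swE_adj, Set.mem_insert_iff, Set.mem_sdiff, Set.mem_singleton_iff,
          Sym2.eq_iff]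
        tauto
    rw [← hT.2]
    change (swE T a b u v).edgeSet.ncard + 1 = T.edgeSet.ncard + 1
    rw [this, Set.ncard_insert_of_notMem (fun h => huv h.1) (Set.toFinite _),
      Set.ncard_sdiff_singleton_add_one (show s(a, b) ∈ T.edgeSet from hab) (Set.toFinite _)]

open Classical in
lemma gdeg_eq {V : Type} [Fintype V] (T : SimpleGraph V) (v : V) :
    gdeg T v = (Finset.univ.filter (fun w => T.Adj v w)).card := by
  unfold gdeg
  rw [← Set.ncard_coe_finset]
  change (T.neighborSet v).ncard = _
  congr 1
  ext w; simp

open Classical in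
lemma swE_deg {V : Type} [Fintype V] {T : SimpleGraph V} {a b u v : V}
    (hab : T.Adj a b) (huv : ¬ T.Adj u v) (hne : u ≠ v) (t : V) :
    gdeg (swE T a b u v) t + (if t = a ∨ t = b then 1 else 0) =
      gdeg T t + (if t = u ∨ t = v then 1 else 0) := by
  have hvu : ¬ T.Adj v u := fun h => huv h.symm
  have hba := hab.symm
  have hab' := hab.ne
  -- count through the cut graph
  have e1 : gdeg (cutE T a b) t + (if t = a ∨ t = b then 1 else 0) = gdeg T t := by
    rw [gdeg_eq, gdeg_eq]
    by_cases hta : t = a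
    · subst hta
      rw [if_pos (Or.inl rfl), ← Finset.card_erase_add_one (a := b) (s := Finset.univ.filter (fun w => T.Adj t w)) (by simpa using hab)]
      congr 2; ext w; simp only [Finset.mem_filter, Finset.mem_univ, true_and, Finset.mem_erase, cutE_adj]; grind
    by_cases htb : t = b
    · subst htb
      rw [if_pos (Or.inr rfl), ← Finset.card_erase_add_one (a := a) (s := Finset.univ.filter (fun w => T.Adj t w)) (by simpa using hba)]
      congr 2; ext w; simp only [Finset.mem_filter, Finset.mem_univ, true_and, Finset.mem_erase, cutE_adj]; grind
    · rw [if_neg (by tauto)]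
      simp [cutE_adj, hta, htb]
  have e2 : gdeg (swE T a b u v) t = gdeg (cutE T a b) t + (if t = u ∨ t = v then 1 else 0) := by
    rw [gdeg_eq, gdeg_eq]
    by_cases hta : t = u
    · subst hta
      rw [if_pos (Or.inl rfl), ← Finset.card_insert_of_notMem (a := v) (s := Finset.univ.filter (fun w => (cutE T a b).Adj t w)) (by simp [cutE_adj, huv])]
      congr 1; ext w; simp only [Finset.mem_filter, Finset.mem_univ, true_and, Finset.mem_insert, cutE_adj, swE_adj]; grind
    by_cases htb : t = v
    · subst htb
      rw [if_pos (Or.inr rfl), ← Finset.card_insert_of_notMem (a := u) (s := Finset.univ.filter (fun w => (cutE T a b).Adj t w)) (by simp [cutE_adj, hvu])]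
      congr 1; ext w; simp only [Finset.mem_filter, Finset.mem_univ, true_and, Finset.mem_insert, cutE_adj, swE_adj]; grind
    · rw [if_neg (by tauto)]
      simp [cutE_adj, swE_adj, hta, htb]
  omega

/-- `p` is the parent function of the tree `T` rooted at `r`. -/
structure Par {V : Type} (T : SimpleGraph V) (r : V) (p : V → V) : Prop where
  root : p r = r
  adj : ∀ v, v ≠ r → T.Adj v (p v)
  dist : ∀ v, v ≠ r → T.dist r v = T.dist r (p v) + 1
  edge : ∀ a b, T.Adj a b → (a ≠ r ∧ p a = b) ∨ (b ≠ r ∧ p b = a)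

lemma exists_par {V : Type} [Fintype V] {T : SimpleGraph V} (hT : T.IsTree) (r : V) :
    ∃ p, Par T r p := by
  classical
  have h1 : ∀ v, ∃ w, (v = r → w = r) ∧ (v ≠ r → T.Adj v w ∧ T.dist r v = T.dist r w + 1) := by
    intro v
    by_cases hv : v = r
    · exact ⟨r, by simp [hv]⟩
    obtain ⟨q, hq⟩ := hT.connected.exists_walk_length_eq_dist v r
    cases q with
    | nil => exact absurd rfl hv
    | @cons _ w _ hadj q =>
      refine ⟨w, fun h => absurd h hv, fun _ => ⟨hadj, ?_⟩⟩
      have h2 := dist_le q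
      have h3 := hT.dist_eq_dist_add_one_of_adj r hadj
      rw [Walk.length_cons] at hq
      rw [dist_comm (u := v)] at hq
      rw [dist_comm (u := w)] at h2
      omega
  choose p hp1 hp2 using h1
  have hinj : Set.InjOn (fun v => s(v, p v)) {v | v ≠ r} := by
    intro a ha b hb hab
    have ha' := hp2 a ha
    have hb' := hp2 b hb
    simp only [Sym2.eq_iff] at hab
    rcases hab with h | h
    · exact h.1
    · have ha2 := ha'.2
      have hb2 := hb'.2
      rw [h.2] at ha2
      rw [← h.1] at hb2
      omega
  have hsub : (fun v => s(v, p v)) '' {v | v ≠ r} ⊆ T.edgeSet := by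
    rintro _ ⟨v, hv, rfl⟩
    exact (hp2 v hv).1
  have hc := (isTree_iff_connected_and_card.1 hT).2
  have heq : (fun v => s(v, p v)) '' {v | v ≠ r} = T.edgeSet := by
    apply Set.eq_of_subset_of_ncard_le hsub
    rw [hinj.ncard_image]
    have h4 : ({v | v ≠ r} : Set V) = {r}ᶜ := by ext; simp
    rw [h4, Set.ncard_compl, Set.ncard_singleton]
    change T.edgeSet.ncard + 1 = _ at hc
    omega
  refine ⟨p, hp1 r rfl, fun v hv => (hp2 v hv).1, fun v hv => (hp2 v hv).2, fun a b hab => ?_⟩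
  have : s(a, b) ∈ T.edgeSet := hab
  rw [← heq] at this
  obtain ⟨v, hv, hv'⟩ := this
  simp only [Sym2.eq_iff] at hv'
  rcases hv' with ⟨rfl, rfl⟩ | ⟨rfl, rfl⟩
  · exact Or.inl ⟨hv, rfl⟩
  · exact Or.inr ⟨hv, rfl⟩

/-- The graph of a parent function is a tree. -/
lemma pg_tree {V : Type} [Fintype V] {T : SimpleGraph V} {r : V} {p : V → V}
    (h1 : ∀ v, T.Reachable v r)
    (h2 : ∀ a b, T.Adj a b → (a ≠ r ∧ p a = b) ∨ (b ≠ r ∧ p b = a)) : T.IsTree := by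
  classical
  have hconn : T.Connected := by
    have : Nonempty V := ⟨r⟩
    exact Connected.mk fun s t => (h1 s).trans (h1 t).symm
  rw [isTree_iff_connected_and_card]
  refine ⟨hconn, le_antisymm ?_ hconn.card_vert_le_card_edgeSet_add_one⟩
  have hsub : T.edgeSet ⊆ (fun v => s(v, p v)) '' {r}ᶜ := by
    intro e
    induction e with
    | h a b =>
      intro hab
      rcases h2 a b hab with h | h
      · exact ⟨a, h.1, by simp [h.2]⟩
      · exact ⟨b, h.1, by simp [h.2, Sym2.eq_swap]⟩
  have h5 := (Set.ncard_le_ncard hsub (Set.toFinite _)).trans (Set.ncard_image_le (Set.toFinite _))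
  rw [Set.ncard_compl, Set.ncard_singleton] at h5
  have h6 : 0 < Nat.card V := Nat.card_pos_iff.2 ⟨⟨r⟩, inferInstance⟩
  change T.edgeSet.ncard + 1 ≤ _
  omega

/-- `a` lies in the subtree of `v`. -/
def Below {V : Type} (p : V → V) (v a : V) : Prop := ∃ n : ℕ, p^[n] a = v

lemma Below.rfl' {V : Type} {p : V → V} {v : V} : Below p v v := ⟨0, rfl⟩

lemma below_of_parent {V : Type} {p : V → V} {v a : V} (h : Below p v (p a)) : Below p v a := by
  obtain ⟨n, hn⟩ := h
  exact ⟨n + 1, by simpa using hn⟩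

lemma below_parent {V : Type} {p : V → V} {v a : V} (h : Below p v a) (hne : a ≠ v) :
    Below p v (p a) := by
  obtain ⟨n, hn⟩ := h
  cases n with
  | zero => exact absurd hn hne
  | succ n => exact ⟨n, by simpa using hn⟩

lemma par_induct {V : Type} {T : SimpleGraph V} {r : V} {p : V → V} (hp : Par T r p)
    {Q : V → Prop} (h0 : Q r) (h : ∀ v, v ≠ r → Q (p v) → Q v) (v : V) : Q v := by
  induction hn : T.dist r v using Nat.strong_induction_on generalizing v with
  | _ n ih =>
    by_cases hv : v = r
    · rw [hv]; exact h0
    · exact h v hv (ih _ (by have := hp.dist v hv; omega) _ rfl)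

lemma Below.dist_le {V : Type} {T : SimpleGraph V} {r : V} {p : V → V} (hp : Par T r p)
    {v a : V} (h : Below p v a) : a = v ∨ T.dist r v < T.dist r a := by
  obtain ⟨n, hn⟩ := h
  induction n generalizing a with
  | zero => exact Or.inl hn
  | succ n ih =>
    by_cases ha : a = r
    · left
      rw [← hn, ha]
      exact (Function.iterate_fixed hp.root _).symm
    · right
      have := hp.dist a ha
      rcases ih (a := p a) (by simpa using hn) with h | h
      · rw [← h]; omega
      · omega

lemma not_below_parent {V : Type} {T : SimpleGraph V} {r : V} {p : V → V} (hp : Par T r p)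
    {v : V} (hv : v ≠ r) : ¬ Below p v (p v) := by
  intro h
  have := hp.dist v hv
  rcases h.dist_le hp with h | h
  · rw [h] at this; omega
  · omega

lemma not_below_root {V : Type} {T : SimpleGraph V} {r : V} {p : V → V} (hp : Par T r p)
    {v : V} (hv : v ≠ r) : ¬ Below p v r := by
  intro h
  rcases h.dist_le hp with h | h
  · exact hv h.symm
  · simp at h

lemma below_linear {V : Type} {p : V → V} {u v a : V} (hu : Below p u a) (hv : Below p v a) :
    Below p u v ∨ Below p v u := by
  obtain ⟨n, rfl⟩ := hu
  obtain ⟨m, rfl⟩ := hv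
  rcases le_total n m with h | h
  · right; exact ⟨m - n, by rw [← Function.iterate_add_apply]; congr 1; omega⟩
  · left; exact ⟨n - m, by rw [← Function.iterate_add_apply]; congr 1; omega⟩

/-- Climbing: if `P` is kept when passing to the parent and `H` joins a `P`-vertex to its parent,
every `P`-vertex is joined to the root. -/
lemma climb {V : Type} {T H : SimpleGraph V} {r : V} {p : V → V} (hp : Par T r p)
    {P : V → Prop} (h : ∀ v, v ≠ r → P v → H.Reachable v r ∨ (H.Adj v (p v) ∧ P (p v)))
    (v : V) : P v → H.Reachable v r := by
  refine par_induct hp (Q := fun v => P v → H.Reachable v r) (fun _ => Reachable.refl _) ?_ v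
  intro v hv ih hPv
  rcases h v hv hPv with h1 | ⟨h1, h2⟩
  · exact h1
  · exact h1.reachable.trans (ih h2)

lemma cut_reach_root {V : Type} {T : SimpleGraph V} {r : V} {p : V → V} (hp : Par T r p)
    {x a : V} (ha : ¬ Below p x a) : (cutE T x (p x)).Reachable a r := by
  refine climb hp (P := fun a => ¬ Below p x a) ?_ a ha
  intro v hv hb
  right
  refine ⟨⟨hp.adj v hv, ?_, ?_⟩, fun h => hb (below_of_parent h)⟩
  · rintro ⟨h, _⟩; exact hb (h ▸ Below.rfl')
  · rintro ⟨_, h⟩; exact hb (below_of_parent (h ▸ Below.rfl'))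

lemma cut_reach_below {V : Type} {T : SimpleGraph V} {r : V} {p : V → V} (hp : Par T r p)
    {x a : V} (hx : x ≠ r) (ha : Below p x a) : (cutE T x (p x)).Reachable a x := by
  refine par_induct hp (Q := fun a => Below p x a → (cutE T x (p x)).Reachable a x) ?_ ?_ a ha
  · intro h; exact absurd h (not_below_root hp hx)
  intro v hv ih hb
  by_cases hvx : v = x
  · rw [hvx]
  have hb' := below_parent hb hvx
  refine Reachable.trans (Adj.reachable ⟨hp.adj v hv, fun h => hvx h.1, ?_⟩) (ih hb')
  rintro ⟨h1, h2⟩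
  rw [h1] at hb
  exact not_below_parent hp hx hb

/-- Swap lemma for rooted trees. -/
lemma swap_tree {V : Type} [Fintype V] {T : SimpleGraph V} (hT : T.IsTree) {r : V} {p : V → V}
    (hp : Par T r p) {x u z : V} (hx : x ≠ r) (hz : Below p x z) (hu : ¬ Below p x u)
    (huz : ¬ T.Adj u z) : (swE T x (p x) u z).IsTree := by
  apply swE_tree hT (hp.adj x hx) huz
  · rintro rfl; exact hu hz
  · exact (cut_reach_below hp hx hz).symm
  · exact (cut_reach_root hp (not_below_parent hp hx)).trans (cut_reach_root hp hu).symm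

/-- The edges of `T` with exactly one end in `C`. -/
def crossE {V : Type} (T : SimpleGraph V) (C : Finset V) : SimpleGraph V where
  Adj s t := T.Adj s t ∧ (s ∈ C ↔ t ∉ C)
  symm := ⟨fun _ _ h => ⟨h.1.symm, by tauto⟩⟩
  loopless := ⟨fun _ h => h.1.ne rfl⟩

lemma crossE_adj {V : Type} (T : SimpleGraph V) (C : Finset V) (s t : V) :
    (crossE T C).Adj s t ↔ T.Adj s t ∧ (s ∈ C ↔ t ∉ C) := Iff.rfl

/-- The class of admissible spanning trees. -/
structure Cls {V : Type} (G : SimpleGraph V) (C : Finset V) (T : SimpleGraph V) : Prop where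
  le : T ≤ G
  tree : T.IsTree
  ii : ∀ a, a ∉ C → ∃ c ∈ C, T.Adj a c
  iii : ∀ c ∈ C, 7 ≤ gdeg (crossE T C) c
  iv : ∀ a b, G.Adj a b → (a ∈ C ↔ b ∉ C) → (crossE T C).Reachable a b

lemma gdeg_mono {V : Type} [Fintype V] {S T : SimpleGraph V} (h : S ≤ T) (v : V) :
    gdeg S v ≤ gdeg T v := by
  classical
  rw [gdeg_eq, gdeg_eq]
  apply Finset.card_le_card
  intro w
  simp only [Finset.mem_filter, Finset.mem_univ, true_and]
  exact fun h' => h h'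

lemma Cls.deg_center {V : Type} [Fintype V] {G : SimpleGraph V} {C : Finset V} {T : SimpleGraph V}
    (h : Cls G C T) {c : V} (hc : c ∈ C) : 7 ≤ gdeg T c :=
  (h.iii c hc).trans (gdeg_mono (S := crossE T C) (fun _ _ h => h.1) c)

lemma deg_ge_one {V : Type} [Fintype V] {T : SimpleGraph V} {v a : V} (ha : T.Adj v a) :
    1 ≤ gdeg T v := by
  classical
  rw [gdeg_eq]
  exact Finset.card_pos.2 ⟨a, by simpa using ha⟩

lemma deg_ge_two {V : Type} [Fintype V] {T : SimpleGraph V} {v a b : V} (ha : T.Adj v a)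
    (hb : T.Adj v b) (hab : a ≠ b) : 2 ≤ gdeg T v := by
  classical
  rw [gdeg_eq, ← Finset.card_pair hab]
  apply Finset.card_le_card
  intro w; simp only [Finset.mem_insert, Finset.mem_singleton, Finset.mem_filter, Finset.mem_univ,
    true_and]
  rintro (rfl | rfl) <;> assumption

lemma deg_ge_three {V : Type} [Fintype V] {T : SimpleGraph V} {v a b c : V} (ha : T.Adj v a)
    (hb : T.Adj v b) (hc : T.Adj v c) (hab : a ≠ b) (hac : a ≠ c) (hbc : b ≠ c) :
    3 ≤ gdeg T v := by
  classical
  have : ({a, b, c} : Finset V).card = 3 := Finset.card_eq_three.2 ⟨a, b, c, hab, hac, hbc, rfl⟩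
  rw [gdeg_eq, ← this]
  apply Finset.card_le_card
  intro w; simp only [Finset.mem_insert, Finset.mem_singleton, Finset.mem_filter, Finset.mem_univ,
    true_and]
  rintro (rfl | rfl | rfl) <;> assumption

lemma crossE_swE_in {V : Type} (T : SimpleGraph V) (C : Finset V) {a b u v : V}
    (ha : a ∉ C) (hb : b ∉ C) (hu : u ∉ C) (hv : v ∉ C) :
    crossE (swE T a b u v) C = crossE T C := by
  ext s t
  simp only [crossE_adj, swE_adj]
  constructor
  · rintro ⟨h1 | ⟨_, ⟨rfl, rfl⟩ | ⟨rfl, rfl⟩⟩, h2⟩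
    · exact ⟨h1.1, h2⟩
    · tauto
    · tauto
  · rintro ⟨h1, h2⟩
    refine ⟨Or.inl ⟨h1, ?_, ?_⟩, h2⟩
    · rintro ⟨rfl, rfl⟩; tauto
    · rintro ⟨rfl, rfl⟩; tauto

lemma crossE_swE_cross {V : Type} (T : SimpleGraph V) (C : Finset V) {a b u v : V}
    (huv : u ∈ C ↔ v ∉ C) :
    crossE (swE T a b u v) C = swE (crossE T C) a b u v := by
  ext s t
  simp only [crossE_adj, swE_adj]
  constructor
  · rintro ⟨h1 | ⟨h3, h1⟩, h2⟩
    · exact Or.inl ⟨⟨h1.1, h2⟩, h1.2⟩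
    · exact Or.inr ⟨h3, h1⟩
  · rintro (⟨h1, h2⟩ | ⟨h3, h1⟩)
    · exact ⟨Or.inl ⟨h1.1, h2⟩, h1.2⟩
    · refine ⟨Or.inr ⟨h3, h1⟩, ?_⟩
      rcases h1 with ⟨rfl, rfl⟩ | ⟨rfl, rfl⟩ <;> tauto

lemma Cls.swE_in {V : Type} [Fintype V] {G : SimpleGraph V} {C : Finset V} {T : SimpleGraph V}
    (h : Cls G C T) {a b u v : V} (ha : a ∉ C) (hb : b ∉ C) (hu : u ∉ C) (hv : v ∉ C)
    (hG : G.Adj u v) (ht : (swE T a b u v).IsTree) : Cls G C (swE T a b u v) := by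
  have e := crossE_swE_in T C ha hb hu hv
  refine ⟨?_, ht, ?_, ?_, ?_⟩
  · rintro s t (h1 | ⟨_, ⟨rfl, rfl⟩ | ⟨rfl, rfl⟩⟩)
    · exact h.le h1.1
    · exact hG
    · exact hG.symm
  · intro s hs
    obtain ⟨c, hc, hadj⟩ := h.ii s hs
    refine ⟨c, hc, Or.inl ⟨hadj, ?_, ?_⟩⟩
    · rintro ⟨_, rfl⟩; exact hb hc
    · rintro ⟨_, rfl⟩; exact ha hc
  · rw [e]; exact h.iii
  · rw [e]; exact h.iv

open Classical in
lemma cls_exists {V : Type} [Fintype V] {G : SimpleGraph V} (hG : G.Connected) {C : Finset V}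
    {f : V → V} (h1 : ∀ v, v ∉ C → f v ∈ C ∧ G.Adj v (f v))
    (h2 : ∀ c ∈ C, 7 ≤ ((Finset.univ : Finset V).filter
      (fun v => v ∉ C ∧ f v = c)).card) :
    ∃ T, Cls G C T := by
  let F : SimpleGraph V :=
    { Adj := fun s t => (s ∉ C ∧ f s = t) ∨ (t ∉ C ∧ f t = s)
      symm := ⟨fun s t h => h.symm⟩
      loopless := ⟨fun s h => by
        rcases h with ⟨h, h'⟩ | ⟨h, h'⟩ <;> exact h (h' ▸ (h1 s h).1)⟩ }
  have hFG : F ≤ crossE G C := by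
    rintro s t (⟨hs, rfl⟩ | ⟨ht, rfl⟩)
    · exact ⟨(h1 s hs).2, by simp [hs, (h1 s hs).1]⟩
    · exact ⟨(h1 t ht).2.symm, by simp [ht, (h1 t ht).1]⟩
  have key : ∀ s t, s ∉ C → f s = t → ¬ (F.deleteEdges {s(s, t)}).Reachable s t := by
    rintro s t hs hst ⟨w⟩
    cases w with
    | nil => exact hs (by have := (h1 s hs).1; rwa [hst] at this)
    | cons hadj _ =>
      rw [deleteEdges_adj] at hadj
      rcases hadj with ⟨⟨_, h⟩ | ⟨h, h'⟩, h3⟩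
      · exact h3 (by simp [← h, hst])
      · exact hs (h' ▸ (h1 _ h).1)
  have hFa : F.IsAcyclic := by
    rw [isAcyclic_iff_forall_adj_isBridge]
    rintro s t (⟨hs, rfl⟩ | ⟨ht, rfl⟩)
    · rw [isBridge_iff]; exact key s _ hs rfl
    · rw [Sym2.eq_swap, isBridge_iff]; exact key t _ ht rfl
  obtain ⟨S, hFS, hSG, hSa, hSr⟩ := exists_isAcyclic_reachable_eq_le_of_le_of_isAcyclic hFG hFa
  obtain ⟨T, hST, hTG, hT⟩ := hG.exists_isTree_le_of_le_of_isAcyclic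
    (hSG.trans (fun _ _ h => h.1)) hSa
  have hSc : S ≤ crossE T C := fun s t h => ⟨hST h, (hSG h).2⟩
  refine ⟨T, hTG, hT, ?_, ?_, ?_⟩
  · intro a ha
    exact ⟨f a, (h1 a ha).1, hST (hFS (Or.inl ⟨ha, rfl⟩))⟩
  · intro c hc
    refine (h2 c hc).trans ?_
    rw [gdeg_eq]
    apply Finset.card_le_card
    intro v
    simp only [Finset.mem_filter, Finset.mem_univ, true_and]
    intro hv
    exact hSc (hFS (Or.inr hv))
  · intro a b hab hC
    have : (crossE G C).Reachable a b := Adj.reachable ⟨hab, hC⟩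
    rw [← hSr] at this
    exact this.mono hSc

/-- Adjacent vertices of degree two. -/
def BadP {V : Type} (T : SimpleGraph V) (a b : V) : Prop :=
  T.Adj a b ∧ gdeg T a = 2 ∧ gdeg T b = 2

lemma BadP.symm {V : Type} {T : SimpleGraph V} {a b : V} (h : BadP T a b) : BadP T b a :=
  ⟨h.1.symm, h.2.2, h.2.1⟩

open Classical in
/-- The ordered bad pairs. -/
noncomputable def badS {V : Type} [Fintype V] (T : SimpleGraph V) : Finset (V × V) :=
  Finset.univ.filter (fun q => BadP T q.1 q.2)

lemma mem_badS {V : Type} [Fintype V] (T : SimpleGraph V) (a b : V) :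
    (a, b) ∈ badS T ↔ BadP T a b := by simp [badS]

/-- Sum of the distances to the root. -/
noncomputable def sumD {V : Type} [Fintype V] (T : SimpleGraph V) (r : V) : ℕ :=
  ∑ v, T.dist r v

lemma Cls.bad_notC {V : Type} [Fintype V] {G : SimpleGraph V} {C : Finset V} {T : SimpleGraph V}
    (h : Cls G C T) {a b : V} (hab : BadP T a b) : a ∉ C ∧ b ∉ C := by
  constructor
  · intro hc; have := h.deg_center hc; have := hab.2.1; omega
  · intro hc; have := h.deg_center hc; have := hab.2.2; omega

lemma Cls.bad_unique {V : Type} [Fintype V] {G : SimpleGraph V} {C : Finset V}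
    {T : SimpleGraph V} (h : Cls G C T) {a b b' : V} (hab : BadP T a b) (hab' : BadP T a b') :
    b = b' := by
  by_contra hne
  obtain ⟨c, hc, hadj⟩ := h.ii a (h.bad_notC hab).1
  have := deg_ge_three hab.1 hab'.1 hadj hne (fun e => (h.bad_notC hab).2 (e ▸ hc))
    (fun e => (h.bad_notC hab').2 (e ▸ hc))
  have := hab.2.1
  omega

lemma bad_lt {V : Type} [Fintype V] {T T' : SimpleGraph V}
    (h : ∀ s t, BadP T' s t → BadP T s t) {a b : V} (h1 : BadP T a b) (h2 : ¬ BadP T' a b) :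
    (badS T').card < (badS T).card := by
  apply Finset.card_lt_card
  rw [Finset.ssubset_iff_of_subset]
  · exact ⟨(a, b), (mem_badS _ _ _).2 h1, fun h => h2 ((mem_badS _ _ _).1 h)⟩
  · rintro ⟨s, t⟩ hst
    exact (mem_badS _ _ _).2 (h s t ((mem_badS _ _ _).1 hst))

/-- Minimality of the chosen tree. -/
def MinT {V : Type} [Fintype V] (G : SimpleGraph V) (C : Finset V) (r : V) (T : SimpleGraph V) :
    Prop := Cls G C T ∧ ∀ T', Cls G C T' → (badS T).card < (badS T').card ∨
      ((badS T).card = (badS T').card ∧ sumD T r ≤ sumD T' r)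

lemma minT_exists {V : Type} [Fintype V] {G : SimpleGraph V} {C : Finset V} (r : V)
    (h : ∃ T, Cls G C T) : ∃ T, MinT G C r T := by
  obtain ⟨T, hT, hmin⟩ := Set.exists_min_image {T | Cls G C T}
    (fun T => toLex ((badS T).card, sumD T r)) (Set.toFinite _) h
  refine ⟨T, hT, fun T' hT' => ?_⟩
  have := hmin T' hT'
  rw [Prod.Lex.le_iff] at this
  simpa using this

/-- Lower ends of bad edges. -/
def InX {V : Type} (T : SimpleGraph V) (r : V) (p : V → V) (x : V) : Prop :=
  x ≠ r ∧ gdeg T x = 2 ∧ gdeg T (p x) = 2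

lemma InX.bad {V : Type} {T : SimpleGraph V} {r : V} {p : V → V} {x : V} (h : InX T r p x)
    (hp : Par T r p) : BadP T x (p x) := ⟨hp.adj x h.1, h.2.1, h.2.2⟩

lemma MinT.absurd_lt {V : Type} [Fintype V] {G : SimpleGraph V} {C : Finset V} {r : V}
    {T T' : SimpleGraph V} (hm : MinT G C r T) (hT' : Cls G C T')
    (h : (badS T').card < (badS T).card) : False := by
  rcases hm.2 T' hT' with h' | h' <;> omega

lemma caseB {V : Type} [Fintype V] {G : SimpleGraph V} {C : Finset V} {r : V}
    {T : SimpleGraph V} {p : V → V} (hm : MinT G C r T) (hp : Par T r p) {x z : V}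
    (hx : InX T r p x) (hz : z ∉ C) (hG : G.Adj x z) (hxz : ¬ T.Adj x z) (hb : ¬ Below p x z) :
    gdeg T z ≤ 1 := by
  by_contra hdeg
  have hbad := hx.bad hp
  obtain ⟨hxC, hyC⟩ := hm.1.bad_notC hbad
  have htree := swap_tree hm.1.tree hp hx.1 (u := z) (z := x) Below.rfl' hb (fun h => hxz h.symm)
  have hcls := hm.1.swE_in hxC hyC hz hxC hG.symm htree
  have hd := swE_deg (hp.adj x hx.1) (fun h => hxz h.symm) hG.ne.symm
  have hzx : z ≠ x := hG.ne.symm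
  have hzy : z ≠ p x := by rintro rfl; exact hxz (hp.adj x hx.1)
  have hyx : p x ≠ x := (hp.adj x hx.1).ne.symm
  have dy := hd (p x)
  rw [if_pos (Or.inr rfl), if_neg (by tauto)] at dy
  have dz := hd z
  rw [if_neg (by tauto), if_pos (Or.inl rfl)] at dz
  have dother : ∀ t, t ≠ p x → t ≠ z → gdeg (swE T x (p x) z x) t = gdeg T t := by
    intro t h1 h2
    have := hd t
    by_cases h3 : t = x
    · rw [if_pos (Or.inl h3), if_pos (Or.inr h3)] at this; omega
    · rw [if_neg (by tauto), if_neg (by tauto)] at this; omega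
  have hx3 := hx.2.2
  refine hm.absurd_lt hcls (bad_lt ?_ hbad ?_)
  · intro s t hst
    have hs1 : s ≠ p x := by rintro rfl; have := hst.2.1; omega
    have hs2 : s ≠ z := by rintro rfl; have := hst.2.1; omega
    have ht1 : t ≠ p x := by rintro rfl; have := hst.2.2; omega
    have ht2 : t ≠ z := by rintro rfl; have := hst.2.2; omega
    refine ⟨?_, by rw [← dother s hs1 hs2]; exact hst.2.1, by rw [← dother t ht1 ht2]; exact hst.2.2⟩
    rcases hst.1 with h | ⟨_, h | h⟩
    · exact h.1
    · exact absurd h.1 hs2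
    · exact absurd h.2 ht2
  · intro h
    have := h.2.2
    omega

lemma caseC {V : Type} [Fintype V] {G : SimpleGraph V} {C : Finset V} {r : V}
    {T : SimpleGraph V} {p : V → V} (hm : MinT G C r T) (hp : Par T r p) {x x' z : V}
    (hx : InX T r p x) (hx' : InX T r p x') (hne : x ≠ x') (hxx : Below p x x')
    (hz : z ∉ C) (hpz : p z ∈ C) (hG : G.Adj x z) (hxz : ¬ T.Adj x z) (hb : Below p x' z) :
    False := by
  have hbad := hx.bad hp
  have hbad' := hx'.bad hp
  obtain ⟨hxC, hyC⟩ := hm.1.bad_notC hbad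
  obtain ⟨hxC', hyC'⟩ := hm.1.bad_notC hbad'
  have hzr : z ≠ r := by rintro rfl; exact not_below_root hp hx'.1 hb
  have hb2 : ¬ Below p x' x := by
    intro h
    rcases h.dist_le hp with h1 | h1
    · exact hne h1
    · rcases hxx.dist_le hp with h2 | h2
      · exact hne h2.symm
      · omega
  have htree := swap_tree hm.1.tree hp hx'.1 (u := x) (z := z) hb hb2 hxz
  have hcls := hm.1.swE_in hxC' hyC' hxC hz hG htree
  have hd := swE_deg (hp.adj x' hx'.1) hxz hG.ne
  have hzx : z ≠ x := hG.ne.symm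
  have hzx' : z ≠ x' := by rintro rfl; exact hyC' hpz
  have hzy : z ≠ p x' := by rintro rfl; exact not_below_parent hp hx'.1 hb
  have hyx : p x' ≠ x := by
    intro h
    have e1 := hbad'.symm
    rw [h] at e1
    have e2 := hm.1.bad_unique hbad e1
    have e3 := hp.dist x hx.1
    have e4 := hp.dist x' hx'.1
    rw [h] at e4
    rw [e2] at e3
    omega
  have hyx' : p x' ≠ x' := (hp.adj x' hx'.1).ne.symm
  have dy := hd (p x')
  rw [if_pos (Or.inr rfl), if_neg (by tauto)] at dy
  have dx' := hd x'
  rw [if_pos (Or.inl rfl), if_neg (by tauto)] at dx'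
  have dx := hd x
  rw [if_neg (by tauto), if_pos (Or.inl rfl)] at dx
  have dz := hd z
  rw [if_neg (by tauto), if_pos (Or.inr rfl)] at dz
  have dother : ∀ t, t ≠ x → t ≠ x' → t ≠ p x' → t ≠ z →
      gdeg (swE T x' (p x') x z) t = gdeg T t := by
    intro t h1 h2 h3 h4
    have := hd t
    rw [if_neg (by tauto), if_neg (by tauto)] at this; omega
  have hx1 := hx.2.1
  have hx1' := hx'.2.1
  have hx2' := hx'.2.2
  have hzno : ∀ t, ¬ BadP (swE T x' (p x') x z) z t := by
    intro t hst
    rcases hst.1 with h | ⟨_, h | h⟩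
    · have h5 := hst.2.1
      have : t ≠ p z := by
        rintro rfl
        exact (hcls.bad_notC hst).2 hpz
      have := deg_ge_two h.1 (hp.adj z hzr) this
      omega
    · exact hzx h.1
    · have h5 := hst.2.2
      rw [h.2] at h5
      omega
  refine hm.absurd_lt hcls (bad_lt ?_ hbad' ?_)
  · have aux : ∀ s t, BadP (swE T x' (p x') x z) s t →
        s ≠ x ∧ s ≠ x' ∧ s ≠ p x' ∧ s ≠ z := by
      intro s t hst
      have := hst.2.1
      refine ⟨?_, ?_, ?_, ?_⟩
      · rintro rfl; omega
      · rintro rfl; omega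
      · rintro rfl; omega
      · rintro rfl; exact hzno t hst
    intro s t hst
    obtain ⟨s1, s2, s3, s4⟩ := aux s t hst
    obtain ⟨t1, t2, t3, t4⟩ := aux t s hst.symm
    refine ⟨?_, by rw [← dother s s1 s2 s3 s4]; exact hst.2.1,
      by rw [← dother t t1 t2 t3 t4]; exact hst.2.2⟩
    rcases hst.1 with h | ⟨_, h | h⟩
    · exact h.1
    · exact absurd h.1 s1
    · exact absurd h.1 s4
  · intro h
    have := h.2.2
    omega

lemma sumD_lt {V : Type} [Fintype V] {T : SimpleGraph V} {r : V} {p : V → V} (hp : Par T r p)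
    (hT : T.IsTree) {x z : V} (hz : z ≠ r)
    (hT' : (swE T z (p z) x z).IsTree) (hxz : x ≠ z) (hd : T.dist r x < T.dist r (p z)) :
    sumD (swE T z (p z) x z) r < sumD T r := by
  set T' := swE T z (p z) x z with hT'def
  have hc := hT'.connected
  have hz' := hp.dist z hz
  have stp : ∀ v, v ≠ r → v ≠ z → T'.Adj v (p v) := by
    intro v hv hvz
    refine Or.inl ⟨hp.adj v hv, fun h => hvz h.1, ?_⟩
    rintro ⟨h1, h2⟩
    have e := hp.dist v hv
    rw [h2, h1] at e
    omega
  have one : ∀ a b, T'.Adj a b → T'.dist r a ≤ T'.dist r b + 1 := by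
    intro a b hab
    have h1 := hc.dist_triangle (u := r) (v := b) (w := a)
    have h2 := dist_eq_one_iff_adj.2 hab.symm
    omega
  have hlt : ∀ n v, T.dist r v = n → n < T.dist r z → T'.dist r v ≤ T.dist r v := by
    intro n
    induction n with
    | zero =>
      intro v hv _
      have : v = r := ((hT.connected.dist_eq_zero_iff).1 hv).symm
      rw [this]; simp
    | succ n ih =>
      intro v hv hn
      have hvr : v ≠ r := by rintro rfl; simp at hv
      have hvz : v ≠ z := by rintro rfl; omega
      have e := hp.dist v hvr
      have := ih (p v) (by omega) (by omega)
      have := one v (p v) (stp v hvr hvz)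
      omega
  have hzlt : T'.dist r z < T.dist r z := by
    have h1 := hlt _ x rfl (by omega)
    have h2 := one z x (Or.inr ⟨hxz, Or.inr ⟨rfl, rfl⟩⟩)
    omega
  have hall : ∀ v, T'.dist r v ≤ T.dist r v := by
    intro v
    refine par_induct hp (Q := fun v => T'.dist r v ≤ T.dist r v) (by simp) ?_ v
    intro v hv ih
    by_cases hvz : v = z
    · rw [hvz]; exact hzlt.le
    have := one v (p v) (stp v hv hvz)
    have := hp.dist v hv
    omega
  exact Finset.sum_lt_sum (fun v _ => hall v) ⟨z, Finset.mem_univ _, hzlt⟩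

/-- Common part of cases A and D. -/
lemma caseAD {V : Type} [Fintype V] {G : SimpleGraph V} {C : Finset V} {r : V}
    {T : SimpleGraph V} {p : V → V} (hm : MinT G C r T) (hp : Par T r p) {x z : V}
    (hx : InX T r p x) (hzr : z ≠ r) (hxz : ¬ T.Adj x z) (hne : x ≠ z) (hb : Below p x z)
    (hcls : Cls G C (swE T z (p z) x z)) : False := by
  have hbad := hx.bad hp
  have hwx : p z ≠ x := by rintro rfl; exact hxz (hp.adj z hzr).symm
  have hd := swE_deg (hp.adj z hzr) hxz hne
  have hwz : p z ≠ z := (hp.adj z hzr).ne.symm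
  have hdist : T.dist r x < T.dist r (p z) := by
    rcases (below_parent hb hne.symm).dist_le hp with h | h
    · exact absurd h hwx
    · exact h
  have hsum := sumD_lt hp hm.1.tree hzr hcls.tree hne hdist
  set T' := swE T z (p z) x z with hT'
  have dx := hd x
  rw [if_neg (by tauto), if_pos (Or.inl rfl)] at dx
  have dother : ∀ t, t ≠ x → t ≠ p z → gdeg T' t = gdeg T t := by
    intro t h1 h2
    have := hd t
    by_cases h3 : t = z
    · rw [if_pos (Or.inl h3), if_pos (Or.inr h3)] at this; omega
    · rw [if_neg (by tauto), if_neg (by tauto)] at this; omega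
  have hx1 := hx.2.1
  have hnx : ∀ s t, BadP T' s t → s ≠ x := by
    rintro s t hst rfl
    have := hst.2.1
    omega
  have hold : ∀ s t, BadP T' s t → s ≠ p z → t ≠ p z → BadP T s t := by
    intro s t hst hs ht
    have s1 := hnx s t hst
    have t1 := hnx t s hst.symm
    refine ⟨?_, by rw [← dother s s1 hs]; exact hst.2.1, by rw [← dother t t1 ht]; exact hst.2.2⟩
    rcases hst.1 with h | ⟨_, h | h⟩
    · exact h.1
    · exact absurd h.1 s1
    · exact absurd h.2 t1
  have hle : (badS T').card ≤ (badS T).card := by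
    classical
    by_cases hq : ∃ q, BadP T' (p z) q
    · obtain ⟨q, hq⟩ := hq
      have sub : badS T' ⊆ ((badS T) \ {(x, p x), (p x, x)}) ∪ {(p z, q), (q, p z)} := by
        rintro ⟨s, t⟩ hst
        rw [mem_badS] at hst
        simp only [Finset.mem_union, Finset.mem_sdiff, Finset.mem_insert, Finset.mem_singleton,
          Prod.mk.injEq, mem_badS]
        by_cases hs : s = p z
        · right; left
          rw [hs] at hst
          exact ⟨hs, hcls.bad_unique hst hq⟩
        by_cases ht : t = p z
        · right; right
          rw [ht] at hst
          exact ⟨hcls.bad_unique hst.symm hq, ht⟩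
        left
        refine ⟨hold s t hst hs ht, ?_⟩
        have s1 := hnx s t hst
        have t1 := hnx t s hst.symm
        tauto
      have c1 := Finset.card_le_card sub
      have c2 := Finset.card_union_le ((badS T) \ {(x, p x), (p x, x)}) {(p z, q), (q, p z)}
      have c3 : ({(p z, q), (q, p z)} : Finset (V × V)).card ≤ 2 := Finset.card_le_two
      have c4 : ({(x, p x), (p x, x)} : Finset (V × V)).card = 2 := by
        apply Finset.card_pair
        intro h
        exact hbad.1.ne (Prod.mk.inj h).1
      have c5 : ({(x, p x), (p x, x)} : Finset (V × V)) ⊆ badS T := by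
        intro e he
        simp only [Finset.mem_insert, Finset.mem_singleton] at he
        rcases he with rfl | rfl
        · exact (mem_badS _ _ _).2 hbad
        · exact (mem_badS _ _ _).2 hbad.symm
      have c6 := Finset.card_sdiff_add_card_eq_card c5
      omega
    · push Not at hq
      apply Finset.card_le_card
      rintro ⟨s, t⟩ hst
      rw [mem_badS] at hst ⊢
      refine hold s t hst ?_ ?_
      · rintro rfl; exact hq t hst
      · rintro rfl; exact hq s hst.symm
  rcases hm.2 T' hcls with h | h <;> omega

lemma caseD {V : Type} [Fintype V] {G : SimpleGraph V} {C : Finset V} {r : V}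
    {T : SimpleGraph V} {p : V → V} (hm : MinT G C r T) (hp : Par T r p) {x z : V}
    (hx : InX T r p x) (hz : z ∉ C) (hG : G.Adj x z) (hxz : ¬ T.Adj x z) (hb : Below p x z) :
    p z ∈ C := by
  by_contra hpz
  have hzr : z ≠ r := by rintro rfl; exact not_below_root hp hx.1 hb
  have hxC := (hm.1.bad_notC (hx.bad hp)).1
  have hnb : ¬ Below p z x := by
    intro h
    rcases h.dist_le hp with h1 | h1
    · exact hG.ne h1
    · rcases hb.dist_le hp with h2 | h2
      · exact hG.ne h2.symm
      · omega
  have htree := swap_tree hm.1.tree hp hzr (u := x) (z := z) Below.rfl' hnb hxz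
  exact caseAD hm hp hx hzr hxz hG.ne hb (hm.1.swE_in hz hpz hxC hz hG htree)

/-- Chains of `E`-edges going upwards and ending in `x`. -/
inductive UpChain {V : Type} (p : V → V) (E : V → V → Prop) (x : V) : V → Prop
  | base : UpChain p E x x
  | step (v : V) : E v (p v) → UpChain p E x (p v) → UpChain p E x v

lemma UpChain.isBelow {V : Type} {p : V → V} {E : V → V → Prop} {x v : V}
    (h : UpChain p E x v) : Below p x v := by
  induction h with
  | base => exact Below.rfl'
  | step v _ _ ih => exact below_of_parent ih

lemma caseA {V : Type} [Fintype V] {G : SimpleGraph V} {C : Finset V} {r : V}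
    {T : SimpleGraph V} {p : V → V} (hm : MinT G C r T) (hp : Par T r p) {x z : V}
    (hx : InX T r p x) (hG : G.Adj x z) (hxz : ¬ T.Adj x z) : z ∉ C := by
  intro hz
  obtain ⟨hxC, hyC⟩ := hm.1.bad_notC (hx.bad hp)
  have hr := hm.1.iv x z hG (by tauto)
  have hchain : ∀ a b, (crossE T C).Reachable a b → UpChain p (crossE T C).Adj x a →
      UpChain p (crossE T C).Adj x b := by
    rintro a b ⟨w⟩
    induction w with
    | nil => exact id
    | @cons u v w hadj _ ih =>
      intro hu
      apply ih
      rcases hp.edge u v hadj.1 with ⟨h1, h2⟩ | ⟨h1, h2⟩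
      · cases hu with
        | base =>
          exfalso
          have := hadj.2
          rw [← h2] at this
          tauto
        | step _ _ h => rw [← h2]; exact h
      · refine UpChain.step v ?_ ?_
        · rw [h2]; exact hadj.symm
        · rw [h2]; exact hu
  have hcz := hchain x z hr UpChain.base
  have hb := hcz.isBelow
  have hzr : z ≠ r := by rintro rfl; exact not_below_root hp hx.1 hb
  cases hcz with
  | base => exact hxC hz
  | step _ hzw hcw =>
  have hwC : p z ∉ C := by have := hzw.2; tauto
  have hwb := hcw.isBelow
  have hwr : p z ≠ r := by intro h; rw [h] at hwb; exact not_below_root hp hx.1 hwb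
  have hwx : p z ≠ x := by rintro rfl; exact hxz (hp.adj z hzr).symm
  have hnb : ¬ Below p z x := by
    intro h
    rcases h.dist_le hp with h1 | h1
    · exact hG.ne h1
    · rcases hb.dist_le hp with h2 | h2
      · exact hG.ne h2.symm
      · omega
  have htree := swap_tree hm.1.tree hp hzr (u := x) (z := z) Below.rfl' hnb hxz
  have hww : crossE T C |>.Adj (p z) (p (p z)) := by
    generalize hw : p z = w at *
    cases hcw with
    | base => exact absurd rfl hwx
    | step _ h _ => exact h
  have hreach : ∀ v, UpChain p (crossE T C).Adj x v → ¬ Below p z v →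
      (cutE (crossE T C) z (p z)).Reachable v x := by
    intro v hv
    induction hv with
    | base => intro _; exact Reachable.refl _
    | step v h1 _ ih =>
      intro hvb
      refine Reachable.trans (Adj.reachable ⟨h1, ?_, ?_⟩) (ih fun h => hvb (below_of_parent h))
      · rintro ⟨rfl, _⟩; exact hvb Below.rfl'
      · rintro ⟨_, h⟩; exact hvb (below_of_parent (h ▸ Below.rfl'))
  have hwx' := hreach (p z) hcw (not_below_parent hp hzr)
  have hpd := hp.dist z hzr
  have hpd' := hp.dist (p z) hwr
  have hppz : p (p z) ≠ z := by intro h; rw [h] at hpd'; omega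
  have ecross : crossE (swE T z (p z) x z) C = swE (crossE T C) z (p z) x z :=
    crossE_swE_cross T C (by tauto)
  refine caseAD hm hp hx hzr hxz hG.ne hb ⟨?_, htree, ?_, ?_, ?_⟩
  · rintro s t (h1 | ⟨_, ⟨rfl, rfl⟩ | ⟨rfl, rfl⟩⟩)
    · exact hm.1.le h1.1
    · exact hG
    · exact hG.symm
  · intro a ha
    by_cases haw : a = p z
    · refine ⟨p (p z), by have := hww.2; tauto, Or.inl ⟨?_, ?_, ?_⟩⟩
      · rw [haw]; exact hww.1
      · rintro ⟨h, _⟩; exact ha (h ▸ hz)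
      · rintro ⟨_, h⟩; exact hppz h
    · obtain ⟨c, hc, hadj⟩ := hm.1.ii a ha
      refine ⟨c, hc, Or.inl ⟨hadj, ?_, ?_⟩⟩
      · rintro ⟨h, _⟩; exact ha (h ▸ hz)
      · rintro ⟨h, _⟩; exact haw h
  · intro c hc
    rw [ecross]
    have h1 := hm.1.iii c hc
    have h2 := swE_deg (T := crossE T C) hzw (fun h => hxz h.1) hG.ne c
    have h3 : c ≠ p z := by rintro rfl; exact hwC hc
    by_cases h4 : c = z
    · rw [if_pos (Or.inl h4), if_pos (Or.inr h4)] at h2; omega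
    · rw [if_neg (by tauto)] at h2; omega
  · intro a b hab hC
    rw [ecross]
    refine reach_of_adj ?_ (hm.1.iv a b hab hC)
    have hle := cutE_le_swE (crossE T C) z (p z) x z
    have hzx : (swE (crossE T C) z (p z) x z).Reachable z (p z) := by
      refine Reachable.trans (Adj.reachable ?_) (hwx'.mono hle).symm
      exact Or.inr ⟨hG.ne, Or.inr ⟨rfl, rfl⟩⟩
    intro s t hst
    by_cases hc1 : s = z ∧ t = p z
    · rw [hc1.1, hc1.2]; exact hzx
    by_cases hc2 : s = p z ∧ t = z
    · rw [hc2.1, hc2.2]; exact hzx.symm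
    exact Adj.reachable (Or.inl ⟨hst, hc1, hc2⟩)

lemma InX.parent_ne {V : Type} [Fintype V] {G : SimpleGraph V} {C : Finset V} {r : V}
    {T : SimpleGraph V} {p : V → V} (hc : Cls G C T) (hp : Par T r p) {x x' : V}
    (hx : InX T r p x) (hx' : InX T r p x') : p x' ≠ x := by
  intro h
  have e1 := (hx'.bad hp).symm
  rw [h] at e1
  have e2 := hc.bad_unique (hx.bad hp) e1
  have e3 := hp.dist x hx.1
  have e4 := hp.dist x' hx'.1
  rw [h] at e4
  rw [e2] at e3
  omega

lemma caseE {V : Type} [Fintype V] {G : SimpleGraph V} {C : Finset V} {r : V}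
    {T : SimpleGraph V} {p : V → V} (hm : MinT G C r T) (hp : Par T r p) {x x' z : V}
    (hx : InX T r p x) (hx' : InX T r p x') (hne : x ≠ x') (hz : z ∉ C)
    (hG : G.Adj x z) (hG' : G.Adj x' z) (hxz : ¬ T.Adj x z) (hxz' : ¬ T.Adj x' z)
    (hb : ¬ Below p x z) (hb' : ¬ Below p x' z) : False := by
  have hbad := hx.bad hp
  have hbad' := hx'.bad hp
  obtain ⟨hxC, hyC⟩ := hm.1.bad_notC hbad
  obtain ⟨hxC', hyC'⟩ := hm.1.bad_notC hbad'
  have hzx : z ≠ x := hG.ne.symm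
  have hzx' : z ≠ x' := hG'.ne.symm
  have hzy : z ≠ p x := by rintro rfl; exact hxz (hp.adj x hx.1)
  have hzy' : z ≠ p x' := by rintro rfl; exact hxz' (hp.adj x' hx'.1)
  have hyx : p x ≠ x := (hp.adj x hx.1).ne.symm
  have hyx' : p x' ≠ x' := (hp.adj x' hx'.1).ne.symm
  have n1 : p x' ≠ x := InX.parent_ne hm.1 hp hx hx'
  have n2 : p x ≠ x' := InX.parent_ne hm.1 hp hx' hx
  have n3 : p x ≠ p x' := by
    intro h
    have e := hbad'.symm
    rw [← h] at e
    exact hne (hm.1.bad_unique hbad.symm e)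
  have htree := swap_tree hm.1.tree hp hx.1 (u := z) (z := x) Below.rfl' hb (fun h => hxz h.symm)
  have hcls := hm.1.swE_in hxC hyC hz hxC hG.symm htree
  have hd := swE_deg (hp.adj x hx.1) (fun h => hxz h.symm) hzx
  set T1 := swE T x (p x) z x with hT1
  have hab1 : T1.Adj x' (p x') := Or.inl ⟨hp.adj x' hx'.1, by tauto, by tauto⟩
  have hna1 : ¬ T1.Adj z x' := by
    rintro (h | ⟨_, h | h⟩)
    · exact hxz' h.1.symm
    · exact hne h.2.symm
    · exact hzx h.1
  have hzr : (cutE T1 x' (p x')).Reachable z r := by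
    refine climb hp (P := fun v => ¬ Below p x v ∧ ¬ Below p x' v) ?_ z ⟨hb, hb'⟩
    rintro v hv ⟨b1, b2⟩
    right
    refine ⟨⟨Or.inl ⟨hp.adj v hv, ?_, ?_⟩, ?_, ?_⟩, fun h => b1 (below_of_parent h),
      fun h => b2 (below_of_parent h)⟩
    · rintro ⟨h, _⟩; exact b1 (h ▸ Below.rfl')
    · rintro ⟨_, h⟩; exact b1 (below_of_parent (h ▸ Below.rfl'))
    · rintro ⟨h, _⟩; exact b2 (h ▸ Below.rfl')
    · rintro ⟨_, h⟩; exact b2 (below_of_parent (h ▸ Below.rfl'))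
  have hyr : (cutE T1 x' (p x')).Reachable (p x') r := by
    refine climb hp (P := fun v => ¬ Below p x' v) ?_ (p x') (not_below_parent hp hx'.1)
    rintro v hv b2
    by_cases hvx : v = x
    · left
      refine Reachable.trans (Adj.reachable ⟨?_, ?_, ?_⟩) hzr
      · rw [hvx]; exact Or.inr ⟨hzx, Or.inr ⟨rfl, rfl⟩⟩
      · rintro ⟨h, _⟩; exact hne (hvx.symm.trans h)
      · rintro ⟨_, h⟩; exact hzx' h
    · right
      refine ⟨⟨Or.inl ⟨hp.adj v hv, ?_, ?_⟩, ?_, ?_⟩, fun h => b2 (below_of_parent h)⟩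
      · rintro ⟨h, _⟩; exact hvx h
      · rintro ⟨h1, h2⟩
        have e1 := hp.dist x hx.1
        have e2 := hp.dist v hv
        rw [h2] at e2
        rw [h1] at e2
        omega
      · rintro ⟨h, _⟩; exact b2 (h ▸ Below.rfl')
      · rintro ⟨_, h⟩; exact b2 (below_of_parent (h ▸ Below.rfl'))
  have htree2 : (swE T1 x' (p x') z x').IsTree :=
    swE_tree htree hab1 hna1 hzx' (Reachable.refl _) (hyr.trans hzr.symm)
  have hcls2 := hcls.swE_in hxC' hyC' hz hxC' hG'.symm htree2
  have hd2 := swE_deg hab1 hna1 hzx'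
  set T2 := swE T1 x' (p x') z x' with hT2
  have hz1 : 1 ≤ gdeg T z := by
    obtain ⟨c, _, h⟩ := hm.1.ii z hz
    exact deg_ge_one h
  have dz := hd z
  rw [if_neg (by tauto), if_pos (Or.inl rfl)] at dz
  have dz2 := hd2 z
  rw [if_neg (by tauto), if_pos (Or.inl rfl)] at dz2
  have dy := hd (p x)
  rw [if_pos (Or.inr rfl), if_neg (by tauto)] at dy
  have dy2 := hd2 (p x)
  rw [if_neg (by tauto), if_neg (by tauto)] at dy2
  have dw := hd (p x')
  rw [if_neg (by tauto), if_neg (by tauto)] at dw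
  have dw2 := hd2 (p x')
  rw [if_pos (Or.inr rfl), if_neg (by tauto)] at dw2
  have dother : ∀ t, t ≠ p x → t ≠ p x' → t ≠ z → gdeg T2 t = gdeg T t := by
    intro t h1 h2 h3
    have a1 := hd t
    have a2 := hd2 t
    have b1 : gdeg T1 t = gdeg T t := by
      by_cases h4 : t = x
      · rw [if_pos (Or.inl h4), if_pos (Or.inr h4)] at a1; omega
      · rw [if_neg (by tauto), if_neg (by tauto)] at a1; omega
    by_cases h4 : t = x'
    · rw [if_pos (Or.inl h4), if_pos (Or.inr h4)] at a2; omega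
    · rw [if_neg (by tauto), if_neg (by tauto)] at a2; omega
  have hx3 := hx.2.2
  have hx3' := hx'.2.2
  have aux : ∀ s t, BadP T2 s t → s ≠ p x ∧ s ≠ p x' ∧ s ≠ z := by
    intro s t hst
    have := hst.2.1
    refine ⟨?_, ?_, ?_⟩
    · rintro rfl; omega
    · rintro rfl; omega
    · rintro rfl; omega
  refine hm.absurd_lt hcls2 (bad_lt ?_ hbad ?_)
  · intro s t hst
    obtain ⟨s1, s2, s3⟩ := aux s t hst
    obtain ⟨t1, t2, t3⟩ := aux t s hst.symm
    refine ⟨?_, by rw [← dother s s1 s2 s3]; exact hst.2.1,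
      by rw [← dother t t1 t2 t3]; exact hst.2.2⟩
    rcases hst.1 with h | ⟨_, h | h⟩
    · rcases h.1 with h | ⟨_, h | h⟩
      · exact h.1
      · exact absurd h.1 s3
      · exact absurd h.2 t3
    · exact absurd h.1 s3
    · exact absurd h.2 t3
  · intro h
    exact (aux _ _ h.symm).1 rfl

open Classical in
/-- The final step: reattach one vertex to every lower end of a bad edge. -/
lemma final_step {V : Type} [Fintype V] {G : SimpleGraph V} {C : Finset V} {r : V} (hr : r ∈ C)
    {T : SimpleGraph V} {p : V → V} (hm : MinT G C r T) (hp : Par T r p)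
    (hdeg : ∀ v, 6 ≤ gdeg G v) :
    ∃ T : SimpleGraph V, T ≤ G ∧ T.IsTree ∧
        ∀ a b : V, T.Adj a b → ¬(gdeg T a = 2 ∧ gdeg T b = 2) := by
  have hcls := hm.1
  let X : Finset V := Finset.univ.filter (fun x => InX T r p x)
  have hX : ∀ x, x ∈ X ↔ InX T r p x := by simp [X]
  let B : Finset V := Finset.univ.filter (fun z => z ∉ C ∧ z ≠ r ∧ p z ∈ C)
  have hB : ∀ z, z ∈ B ↔ z ∉ C ∧ z ≠ r ∧ p z ∈ C := by simp [B]
  let R : V → V → Prop := fun x z => G.Adj x z ∧ ¬ T.Adj x z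
  -- leaf or below
  have hRB : ∀ x z, InX T r p x → R x z → z ∈ B ∧ (Below p x z ∨ gdeg T z ≤ 1) := by
    rintro x z hx ⟨h1, h2⟩
    have hz := caseA hm hp hx h1 h2
    have hzr : z ≠ r := by rintro rfl; exact hz hr
    rw [hB]
    by_cases hb : Below p x z
    · exact ⟨⟨hz, hzr, caseD hm hp hx hz h1 h2 hb⟩, Or.inl hb⟩
    · have hd := caseB hm hp hx hz h1 h2 hb
      refine ⟨⟨hz, hzr, ?_⟩, Or.inr hd⟩
      obtain ⟨c, hc, hadj⟩ := hcls.ii z hz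
      by_contra hne
      have : p z ≠ c := by rintro rfl; exact hne hc
      have := deg_ge_two (hp.adj z hzr) hadj this
      omega
  have h1 : ∀ x ∈ X, 2 * 2 * 1 ≤ (B.filter (fun z => R x z)).card := by
    intro x hx
    rw [hX] at hx
    have e1 := hdeg x
    have e2 := hx.2.1
    rw [gdeg_eq] at e1 e2
    have sub : Finset.univ.filter (fun w => G.Adj x w) \ Finset.univ.filter (fun w => T.Adj x w) ⊆
        B.filter (fun z => R x z) := by
      intro z
      simp only [Finset.mem_sdiff, Finset.mem_filter, Finset.mem_univ, true_and]
      intro h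
      exact ⟨(hRB x z hx h).1, h⟩
    have e3 := Finset.card_le_card sub
    have e4 := Finset.le_card_sdiff (Finset.univ.filter (fun w => T.Adj x w))
      (Finset.univ.filter (fun w => G.Adj x w))
    omega
  have h2 : ∀ z ∈ B, (X.filter (fun x => R x z)).card ≤ 2 := by
    intro z hz
    rw [hB] at hz
    have e1 : (X.filter (fun x => R x z ∧ Below p x z)).card ≤ 1 := by
      rw [Finset.card_le_one]
      intro a ha b hb
      simp only [Finset.mem_filter, hX] at ha hb
      by_contra hne
      rcases below_linear ha.2.2 hb.2.2 with h | h
      · exact caseC hm hp ha.1 hb.1 hne h hz.1 hz.2.2 ha.2.1.1 ha.2.1.2 hb.2.2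
      · exact caseC hm hp hb.1 ha.1 (Ne.symm hne) h hz.1 hz.2.2 hb.2.1.1 hb.2.1.2 ha.2.2
    have e2 : (X.filter (fun x => R x z ∧ ¬ Below p x z)).card ≤ 1 := by
      rw [Finset.card_le_one]
      intro a ha b hb
      simp only [Finset.mem_filter, hX] at ha hb
      by_contra hne
      exact caseE hm hp ha.1 hb.1 hne hz.1 ha.2.1.1 hb.2.1.1 ha.2.1.2 hb.2.1.2 ha.2.2 hb.2.2
    have e3 : X.filter (fun x => R x z) = X.filter (fun x => R x z ∧ Below p x z) ∪
        X.filter (fun x => R x z ∧ ¬ Below p x z) := by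
      ext x; simp only [Finset.mem_filter, Finset.mem_union]; tauto
    rw [e3]
    exact (Finset.card_union_le _ _).trans (by omega)
  obtain ⟨g0, hg1, hg2, hg3⟩ := steal X B R p 1 2 (by norm_num)
    (fun x hx => by convert h1 x hx) (fun z hz => by convert h2 z hz)
  let g : V → V := fun x => g0 x 0
  have hgB : ∀ x ∈ X, g x ∈ B := fun x hx => (hg1 x hx 0).1
  have hgR : ∀ x ∈ X, R x (g x) := fun x hx => (hg1 x hx 0).2
  have hginj : ∀ x ∈ X, ∀ x' ∈ X, g x = g x' → x = x' :=
    fun x hx x' hx' h => (hg2 x hx x' hx' 0 0 h).1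
  -- the new parent function
  have hq : ∀ v, ∃ w, (∀ x ∈ X, g x = v → w = x) ∧ ((∀ x ∈ X, g x ≠ v) → w = p v) := by
    intro v
    by_cases h : ∃ x ∈ X, g x = v
    · obtain ⟨x, hx, hv⟩ := h
      exact ⟨x, fun x' hx' h' => hginj x hx x' hx' (hv.trans h'.symm),
        fun h' => absurd hv (h' x hx)⟩
    · push Not at h
      exact ⟨p v, fun x hx h' => absurd h' (h x hx), fun _ => rfl⟩
  choose q hq1 hq2 using hq
  have hqg : ∀ x ∈ X, q (g x) = x := fun x hx => hq1 _ x hx rfl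
  have hcases : ∀ v, (∃ x ∈ X, g x = v ∧ q v = x) ∨ ((∀ x ∈ X, g x ≠ v) ∧ q v = p v) := by
    intro v
    by_cases h : ∃ x ∈ X, g x = v
    · obtain ⟨x, hx, hv⟩ := h
      exact Or.inl ⟨x, hx, hv, hq1 v x hx hv⟩
    · push Not at h
      exact Or.inr ⟨h, hq2 v h⟩
  have hXC : ∀ x ∈ X, x ∉ C ∧ p x ∉ C := fun x hx => hcls.bad_notC (((hX x).1 hx).bad hp)
  have hqadj : ∀ v, v ≠ r → G.Adj v (q v) := by
    intro v hv
    rcases hcases v with ⟨x, hx, rfl, hqx⟩ | ⟨_, hqx⟩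
    · rw [hqx]; exact (hgR x hx).1.symm
    · rw [hqx]; exact hcls.le (hp.adj v hv)
  let T' : SimpleGraph V :=
    { Adj := fun a b => (a ≠ r ∧ q a = b) ∨ (b ≠ r ∧ q b = a)
      symm := ⟨fun a b h => h.symm⟩
      loopless := ⟨fun a h => by
        rcases h with ⟨h, h'⟩ | ⟨h, h'⟩ <;> exact (hqadj a h).ne h'.symm⟩ }
  have hT'G : T' ≤ G := by
    rintro a b (⟨h, rfl⟩ | ⟨h, rfl⟩)
    · exact hqadj a h
    · exact (hqadj b h).symm
  have hadj' : ∀ v, v ≠ r → T'.Adj v (q v) := fun v hv => Or.inl ⟨hv, rfl⟩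
  -- vertices of degree at least two reach the root
  have hreach1 : ∀ n v, T.dist r v = n → 2 ≤ gdeg T v → T'.Reachable v r := by
    intro n
    induction n using Nat.strong_induction_on with
    | _ n ih =>
      intro v hv hd
      by_cases hvr : v = r
      · rw [hvr]
      refine (hadj' v hvr).reachable.trans ?_
      rcases hcases v with ⟨x, hx, hgx, hqx⟩ | ⟨_, hqx⟩
      · rw [hqx]
        have hxX := (hX x).1 hx
        have hR := hgR x hx
        rw [hgx] at hR
        rcases (hRB x v hxX hR).2 with h | h
        · have : T.dist r x < T.dist r v := by
            rcases h.dist_le hp with h' | h'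
            · exact absurd h'.symm hR.1.ne
            · exact h'
          exact ih _ (by omega) x rfl (by have := hxX.2.1; omega)
        · omega
      · rw [hqx]
        have e := hp.dist v hvr
        by_cases hpr : p v = r
        · rw [hpr]
        refine ih _ (by omega) (p v) rfl ?_
        refine deg_ge_two (hp.adj v hvr).symm (hp.adj (p v) hpr) ?_
        intro h
        have e' := hp.dist (p v) hpr
        rw [← h] at e'
        omega
  have hreach : ∀ v, T'.Reachable v r := by
    intro v
    by_cases hvr : v = r
    · rw [hvr]
    refine (hadj' v hvr).reachable.trans ?_
    rcases hcases v with ⟨x, hx, _, hqx⟩ | ⟨_, hqx⟩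
    · rw [hqx]
      exact hreach1 _ x rfl (by have := ((hX x).1 hx).2.1; omega)
    · rw [hqx]
      by_cases hpr : p v = r
      · rw [hpr]
      refine hreach1 _ (p v) rfl ?_
      refine deg_ge_two (hp.adj v hvr).symm (hp.adj (p v) hpr) ?_
      intro h
      have e := hp.dist v hvr
      have e' := hp.dist (p v) hpr
      rw [← h] at e'
      omega
  have htree : T'.IsTree := pg_tree hreach (fun a b h => h)
  -- degrees in the new tree
  have dX : ∀ x ∈ X, 3 ≤ gdeg T' x := by
    intro x hx
    have hxX := (hX x).1 hx
    obtain ⟨hxC, hyC⟩ := hXC x hx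
    obtain ⟨c, hc, hadj⟩ := hcls.ii x hxC
    have hcr : c ≠ r ∧ p c = x := by
      rcases hp.edge x c hadj with h | h
      · exact absurd (h.2 ▸ hc) hyC
      · exact h
    have hxq : q x = p x := by
      rcases hcases x with ⟨x', hx', hgx, _⟩ | ⟨_, h⟩
      · exact absurd ((hB _).1 (hgx ▸ hgB x' hx')).2.2 hyC
      · exact h
    have hcq : q c = p c := by
      rcases hcases c with ⟨x', hx', hgx, _⟩ | ⟨_, h⟩
      · exact absurd hc ((hB _).1 (hgx ▸ hgB x' hx')).1
      · exact h
    have hgx := (hB _).1 (hgB x hx)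
    refine deg_ge_three (a := p x) (b := c) (c := g x) ?_ ?_ ?_ ?_ ?_ ?_
    · rw [← hxq]; exact hadj' x hxX.1
    · exact Or.inr ⟨hcr.1, hcq.trans hcr.2⟩
    · exact Or.inr ⟨hgx.2.1, hqg x hx⟩
    · rintro h; exact hyC (h ▸ hc)
    · intro h
      exact (hgR x hx).2 (h ▸ hp.adj x hxX.1)
    · rintro h; exact hgx.1 (h ▸ hc)
  have dC : ∀ c ∈ C, 3 ≤ gdeg T' c := by
    intro c hc
    have e1 := hcls.iii c hc
    rw [gdeg_eq] at e1
    have e2 := hg3 c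
    -- children of `c` outside `C`
    have s1 : Finset.univ.filter (fun w => (crossE T C).Adj c w) ⊆
        insert (p c) (B.filter (fun b => p b = c)) := by
      intro w
      simp only [Finset.mem_filter, Finset.mem_univ, true_and, Finset.mem_insert, hB]
      rintro ⟨h1, h2⟩
      rcases hp.edge c w h1 with h | h
      · exact Or.inl h.2.symm
      · exact Or.inr ⟨⟨by tauto, h.1, by rw [h.2]; exact hc⟩, h.2⟩
    have e3 := (Finset.card_le_card s1).trans (Finset.card_insert_le _ _)
    have s2 : B.filter (fun b => p b = c) ⊆ Finset.univ.filter (fun w => T'.Adj c w) ∪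
        B.filter (fun b => p b = c ∧ ∃ a ∈ X, ∃ i, g0 a i = b) := by
      intro w
      simp only [Finset.mem_filter, Finset.mem_univ, true_and, Finset.mem_union]
      rintro ⟨h1, h2⟩
      rcases hcases w with ⟨x, hx, hgx, _⟩ | ⟨_, h⟩
      · exact Or.inr ⟨h1, h2, x, hx, 0, hgx⟩
      · exact Or.inl (Or.inr ⟨((hB w).1 h1).2.1, h.trans h2⟩)
    have e4 := (Finset.card_le_card s2).trans (Finset.card_union_le _ _)
    have e5 : (Finset.univ.filter (fun w => T'.Adj c w)).card = gdeg T' c := by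
      rw [gdeg_eq]; congr
    omega
  have dO : ∀ v, v ∉ X → v ∉ C → gdeg T' v = gdeg T v := by
    intro v hvX hvC
    have hvr : v ≠ r := by rintro rfl; exact hvC hr
    -- children agree
    have hch : ∀ w, q w = v ↔ p w = v := by
      intro w
      rcases hcases w with ⟨x, hx, hgx, hqx⟩ | ⟨_, h⟩
      · constructor
        · intro h; exact absurd (by rw [← h, hqx]; exact hx) hvX
        · intro h
          exact absurd (by rw [← h, ← hgx]; exact ((hB _).1 (hgB x hx)).2.2) hvC
      · rw [h]
    have cnt : ∀ (S : SimpleGraph V) (f : V → V), (∀ a b, S.Adj a b ↔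
        (a ≠ r ∧ f a = b) ∨ (b ≠ r ∧ f b = a)) → ¬ (f v ≠ r ∧ f (f v) = v) → 
        gdeg S v = (Finset.univ.filter (fun w => w ≠ r ∧ f w = v)).card + 1 := by
      intro S f hS hf
      rw [gdeg_eq, ← Finset.card_insert_of_notMem (a := f v)]
      · congr 1
        ext w
        simp only [Finset.mem_filter, Finset.mem_univ, true_and, Finset.mem_insert, hS]
        constructor
        · rintro (h | h)
          · exact Or.inl h.2.symm
          · exact Or.inr h
        · rintro (h | h)
          · exact Or.inl ⟨hvr, h.symm⟩
          · exact Or.inr h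
      · simpa using hf
    have c1 := cnt T p (fun a b => ⟨hp.edge a b, by
      rintro (⟨h, rfl⟩ | ⟨h, rfl⟩)
      · exact hp.adj a h
      · exact (hp.adj b h).symm⟩) (by
        rintro ⟨h1, h2⟩
        have e := hp.dist v hvr
        have e' := hp.dist (p v) h1
        rw [h2] at e'
        omega)
    have c2 := cnt T' q (fun a b => Iff.rfl) (by
      rintro ⟨h1, h2⟩
      rw [hch] at h2
      rcases hcases v with ⟨x, hx, hgx, hqx⟩ | ⟨_, h⟩
      · rw [hqx] at h2
        -- then `g x = v = p x`
        exact (hgR x hx).2 (by rw [hgx, ← h2]; exact hp.adj x ((hX x).1 hx).1)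
      · rw [h] at h2 h1
        have e := hp.dist v hvr
        have e' := hp.dist (p v) h1
        rw [h2] at e'
        omega)
    rw [c1, c2]
    congr 3
    ext w
    rw [hch]
  refine ⟨T', hT'G, htree, ?_⟩
  have key : ∀ a, a ≠ r → gdeg T' a = 2 → gdeg T' (q a) = 2 → False := by
    intro a har h1 h2
    have a1 : a ∉ X := fun h => by have := dX a h; omega
    have a2 : a ∉ C := fun h => by have := dC a h; omega
    have b1 : q a ∉ X := fun h => by have := dX _ h; omega
    have b2 : q a ∉ C := fun h => by have := dC _ h; omega
    rw [dO a a1 a2] at h1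
    rw [dO _ b1 b2] at h2
    rcases hcases a with ⟨x, hx, _, hqx⟩ | ⟨_, h⟩
    · exact b1 (hqx ▸ hx)
    · rw [h] at h2
      exact a1 ((hX a).2 ⟨har, h1, h2⟩)
  rintro a b (⟨h, rfl⟩ | ⟨h, rfl⟩) ⟨h1, h2⟩
  · exact key a h h1 h2
  · exact key b h h2 h1

/-- There exists a natural number `d` such that every finite simple connected graph with
minimum degree at least `d` has a spanning tree `T` in which no two vertices of degree 2
(in `T`) are adjacent (in `T`). -/
theorem stmt_0 :
    ∃ d : ℕ, ∀ (V : Type) [Fintype V] (G : SimpleGraph V),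
      G.Connected → (∀ v, d ≤ gdeg G v) →
      ∃ T : SimpleGraph V, T ≤ G ∧ T.IsTree ∧
        ∀ a b : V, T.Adj a b → ¬(gdeg T a = 2 ∧ gdeg T b = 2) := by
  classical
  refine ⟨210, fun V _ G hG hd => ?_⟩
  obtain ⟨C, f, h1, h2⟩ := star_factor G 7 (by norm_num)
    (fun v => by have := hd v; rw [gdeg_eq] at this; exact this)
  obtain ⟨v⟩ := hG.nonempty
  have hr : ∃ r, r ∈ C := by
    by_cases hv : v ∈ C
    · exact ⟨v, hv⟩
    · exact ⟨f v, (h1 v hv).1⟩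
  obtain ⟨r, hr⟩ := hr
  obtain ⟨T, hm⟩ := minT_exists r (cls_exists hG h1 h2)
  obtain ⟨p, hp⟩ := exists_par hm.1.tree r
  exact final_step hr hm hp (fun v => le_trans (by norm_num) (hd v))
end

section
/- Every finite simple connected graph with minimum degree at least 3 contains a spanning tree T without three consecutive vertices of degree 2; that is, T contains no path on three vertices all of which have degree 2 in T. -/
open SimpleGraph

section aux
set_option linter.unusedSectionVars false
variable {V : Type} [Fintype V]

lemma gdeg_eq_zero (T : SimpleGraph V) (u : V) : gdeg T u = 0 ↔ ∀ w, ¬ T.Adj u w := by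
  classical
  unfold gdeg
  rw [Nat.card_eq_zero]
  simp only [Set.isEmpty_coe_sort, Set.eq_empty_iff_forall_notMem, mem_neighborSet,
    not_infinite_iff_finite.mpr inferInstance, or_false]

lemma add_adj (T : SimpleGraph V) {x u : V} (hxu : x ≠ u) (a b : V) :
    (T ⊔ edge x u).Adj a b ↔ T.Adj a b ∨ (a = x ∧ b = u) ∨ (a = u ∧ b = x) := by
  rw [sup_adj, edge_adj]
  grind

open scoped Classical in
lemma gdeg_add (T : SimpleGraph V) {x u : V} (hxu : x ≠ u) (hu : gdeg T u = 0) (a : V) :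
    gdeg (T ⊔ edge x u) a =
      (gdeg T a + if a = x then 1 else if a = u then 1 else 0) := by
  classical
  have hu' := (gdeg_eq_zero T u).1 hu
  by_cases hax : a = x
  · subst hax
    have : (T ⊔ edge a u).neighborSet a = insert u (T.neighborSet a) := by
      ext b; simp only [mem_neighborSet, add_adj T hxu, Set.mem_insert_iff]; grind
    simp only [gdeg, this, if_true]
    rw [Nat.card_coe_set_eq, Nat.card_coe_set_eq, Set.ncard_insert_of_notMem]
    intro h
    exact hu' a ((T.mem_neighborSet _ _).1 h |>.symm)
  · by_cases hau : a = u
    · subst hau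
      have : (T ⊔ edge x a).neighborSet a = {x} := by
        ext b; simp only [mem_neighborSet, add_adj T hxu, Set.mem_singleton_iff]; grind
      rw [hu]
      simp [gdeg, this, hax]
    · have : (T ⊔ edge x u).neighborSet a = T.neighborSet a := by
        ext b; simp only [mem_neighborSet, add_adj T hxu]; grind
      simp [gdeg, this, hax, hau]

/-- Trees (on their support) containing the root `r`. -/
structure Base (G : SimpleGraph V) (r : V) (T : SimpleGraph V) : Prop where
  le : T ≤ G
  acyc : T.IsAcyclic
  reach : ∀ v, gdeg T v ≠ 0 → T.Reachable r v

lemma Base.add {G T : SimpleGraph V} {r x u : V} (h : Base G r T) (hx : T.Reachable r x)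
    (hG : G.Adj x u) (hu : gdeg T u = 0) : Base G r (T ⊔ edge x u) := by
  have hxu := hG.ne
  have hu' := (gdeg_eq_zero T u).1 hu
  have hle : T ≤ T ⊔ edge x u := le_sup_left
  have hrx := hx.mono hle
  refine ⟨?_, ?_, ?_⟩
  · intro a b hab
    rw [add_adj T hxu] at hab
    rcases hab with hab | ⟨rfl, rfl⟩ | ⟨rfl, rfl⟩
    · exact h.le hab
    · exact hG
    · exact hG.symm
  · have hnr : ¬ T.Reachable x u := by
      rintro ⟨p⟩
      cases hp : p.reverse with
      | nil => exact hxu rfl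
      | cons h' _ => exact hu' _ h'
    exact h.acyc.sup_edge_of_not_reachable hnr
  · intro v hv
    by_cases hvu : v = u
    · subst hvu
      exact hrx.trans (Adj.reachable ((add_adj T hxu _ _).2 (Or.inr (Or.inl ⟨rfl, rfl⟩))))
    · by_cases hvx : v = x
      · subst hvx; exact hrx
      · rw [gdeg_add T hxu hu] at hv
        simp only [hvu, hvx, if_false, add_zero] at hv
        exact (h.reach v hv).mono hle

/-- The invariant; leaves in `X` are exempt from the leaf condition. -/
structure GInv (G : SimpleGraph V) (r : V) (X : Set V) (T : SimpleGraph V) : Prop where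
  base : Base G r T
  leaf : ∀ a, a ∉ X → ∀ b w, T.Adj a b → gdeg T a = 1 → G.Adj a w → gdeg T w = 0 → 3 ≤ gdeg T b
  run : ∀ a b c, a ≠ c → T.Adj a b → T.Adj b c → gdeg T a = 2 → gdeg T b = 2 → gdeg T c = 2 → False

/-- Attach a leaf to a vertex of degree at least 2. -/
lemma GInv.addA {G T : SimpleGraph V} {r x u : V} {X : Set V} (h : GInv G r X T)
    (hx : 2 ≤ gdeg T x) (hG : G.Adj x u) (hu : gdeg T u = 0) : GInv G r X (T ⊔ edge x u) := by
  have hxu := hG.ne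
  have hu' := (gdeg_eq_zero T u).1 hu
  have hA := add_adj T hxu
  have hd := gdeg_add T hxu hu
  refine ⟨h.base.add (h.base.reach x (by omega)) hG hu, ?_, ?_⟩
  · intro a haX b w hab ha1 haw hw
    have := h.leaf a haX b w
    grind
  · intro a b c hac hab hbc ha hb hc
    have := h.run a b c hac
    grind

/-- Attach two leaves to a leaf. -/
lemma GInv.addB {G T : SimpleGraph V} {r x u w : V} {X : Set V} (h : GInv G r X T)
    (hx : gdeg T x = 1) (hG : G.Adj x u) (hu : gdeg T u = 0) (hG' : G.Adj x w)
    (hw : gdeg T w = 0) (huw : u ≠ w) : GInv G r X (T ⊔ edge x u ⊔ edge x w) := by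
  have hxu := hG.ne
  have hxw := hG'.ne
  have hu' := (gdeg_eq_zero T u).1 hu
  have hw' := (gdeg_eq_zero T w).1 hw
  have hA := add_adj T hxu
  have hd := gdeg_add T hxu hu
  have hw1 : gdeg (T ⊔ edge x u) w = 0 := by rw [hd]; grind
  have hA' := add_adj (T ⊔ edge x u) hxw
  have hd' := gdeg_add (T ⊔ edge x u) hxw hw1
  have hrx := h.base.reach x (by omega)
  refine ⟨(h.base.add hrx hG hu).add (hrx.mono le_sup_left) hG' hw1, ?_, ?_⟩
  · intro a haX b y hab ha1 hay hy
    have := h.leaf a haX b y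
    grind
  · intro a b c hac hab hbc ha hb hc
    have := h.run a b c hac
    grind

/-- Attach a leaf to a leaf. -/
lemma GInv.addC {G T : SimpleGraph V} {r x u v : V} {X : Set V} (h : GInv G r X T)
    (hx : gdeg T x = 1) (hxv : T.Adj x v)
    (hv : gdeg T v = 2 → ∀ q, q ≠ x → T.Adj v q → gdeg T q ≠ 2)
    (hG : G.Adj x u) (hu : gdeg T u = 0) : GInv G r (insert u X) (T ⊔ edge x u) := by
  have hxu := hG.ne
  have hu' := (gdeg_eq_zero T u).1 hu
  have hA := add_adj T hxu
  have hd := gdeg_add T hxu hu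
  have huniq : ∀ y, T.Adj x y → y = v := by
    unfold gdeg at hx
    rw [Nat.card_coe_set_eq, Set.ncard_eq_one] at hx
    obtain ⟨z, hz⟩ := hx
    have h1 : ∀ y, T.Adj x y ↔ y = z := fun y => by
      rw [← mem_neighborSet, hz, Set.mem_singleton_iff]
    intro y hy
    rw [(h1 y).1 hy, (h1 v).1 hxv]
  have hsymm : ∀ a b, T.Adj a b → T.Adj b a := fun a b h => h.symm
  refine ⟨h.base.add (h.base.reach x (by omega)) hG hu, ?_, ?_⟩
  · intro a haX b w hab ha1 haw hw
    rw [Set.mem_insert_iff, not_or] at haX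
    have := h.leaf a haX.2 b w
    grind
  · intro a b c hac hab hbc ha hb hc
    have := h.run a b c hac
    grind

lemma GInv.drop {G T : SimpleGraph V} {r : V} {X : Set V} (h : GInv G r X T)
    (hX : ∀ a ∈ X, ∀ b w, T.Adj a b → gdeg T a = 1 → G.Adj a w → gdeg T w = 0 → 3 ≤ gdeg T b) :
    GInv G r ∅ T := by
  refine ⟨h.base, ?_, h.run⟩
  intro a _
  by_cases ha : a ∈ X
  · exact hX a ha
  · exact h.leaf a ha


lemma exists_three {G : SimpleGraph V} {v : V} (h : 3 ≤ gdeg G v) :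
    ∃ a b c, G.Adj v a ∧ G.Adj v b ∧ G.Adj v c ∧ a ≠ b ∧ a ≠ c ∧ b ≠ c := by
  unfold gdeg at h
  rw [Nat.card_coe_set_eq] at h
  obtain ⟨a, b, c, ha, hb, hc, h⟩ := (Set.two_lt_ncard_iff (Set.toFinite _)).1 h
  exact ⟨a, b, c, ha, hb, hc, h⟩

lemma exists_start {G : SimpleGraph V} {r : V} (h : 3 ≤ gdeg G r) :
    ∃ T, GInv G r ∅ T ∧ gdeg T r ≠ 0 := by
  obtain ⟨a, b, c, ha, hb, hc, hab, hac, hbc⟩ := exists_three h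
  have h0 : ∀ v, gdeg (⊥ : SimpleGraph V) v = 0 := fun v => (gdeg_eq_zero _ _).2 (by simp)
  have hA := add_adj (⊥ : SimpleGraph V) ha.ne
  have hd := gdeg_add (⊥ : SimpleGraph V) ha.ne (h0 a)
  simp only [bot_adj, h0] at hA hd
  have hB : Base G r ⊥ := ⟨bot_le, isAcyclic_bot, fun v hv => (hv (h0 v)).elim⟩
  have h1 : GInv G r {r, a} (⊥ ⊔ edge r a) := by
    refine ⟨hB.add (Reachable.refl r) ha (h0 a), ?_, ?_⟩
    · intro x hx y w hxy
      simp only [Set.mem_insert_iff, Set.mem_singleton_iff] at hx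
      grind
    · grind
  generalize (⊥ : SimpleGraph V) ⊔ edge r a = T at *
  have hb0 : gdeg T b = 0 := by have := ha.ne; have := hb.ne; grind
  have hc0 : gdeg T c = 0 := by have := ha.ne; have := hc.ne; grind
  have h2 := h1.addB (by grind) hb hb0 hc hc0 hbc
  have hA1 := add_adj T hb.ne
  have hd1 := gdeg_add T hb.ne hb0
  have hc1 : gdeg (T ⊔ edge r b) c = 0 := by have := hb.ne; have := hc.ne; grind
  have hA2 := add_adj (T ⊔ edge r b) hc.ne
  have hd2 := gdeg_add (T ⊔ edge r b) hc.ne hc1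
  refine ⟨_, h2.drop ?_, by grind⟩
  intro x hx y w hxy
  simp only [Set.mem_insert_iff, Set.mem_singleton_iff] at hx
  have := ha.ne
  grind

/-- A non-spanning tree satisfying the invariant can be extended. -/
lemma extend {G T : SimpleGraph V} {r : V} (hdeg : ∀ v, 3 ≤ gdeg G v) (h : GInv G r ∅ T)
    (hmax : ∀ T', GInv G r ∅ T' → T ≤ T' → T' ≤ T) {v u : V} (hv : gdeg T v ≠ 0)
    (hu : gdeg T u = 0) (hvu : G.Adj v u) : False := by
  have key : ∀ {x u : V} {T' : SimpleGraph V}, GInv G r ∅ T' → T ⊔ edge x u ≤ T' → x ≠ u →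
      gdeg T u = 0 → False := by
    intro x u T' hT' hle hxu hu
    have h1 := hmax T' hT' (le_sup_left.trans hle)
    have h2 : T.Adj x u := h1 (hle ((add_adj T hxu _ _).2 (Or.inr (Or.inl ⟨rfl, rfl⟩))))
    exact (gdeg_eq_zero T u).1 hu x h2.symm
  have F1 : ∀ x w, gdeg T x ≠ 0 → gdeg T w = 0 → G.Adj x w → gdeg T x = 1 := by
    intro x w hx hw hxw
    by_contra hne
    exact key (h.addA (by omega) hxw hw) le_rfl hxw.ne hw
  have F2 : ∀ x w w', gdeg T x ≠ 0 → gdeg T w = 0 → G.Adj x w → gdeg T w' = 0 → G.Adj x w' →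
      w = w' := by
    intro x w w' hx hw hxw hw' hxw'
    by_contra hne
    exact key (h.addB (F1 x w hx hw hxw) hxw hw hxw' hw' hne) le_sup_left hxw.ne hw
  have par : ∀ x, gdeg T x ≠ 0 → ∃ p, T.Adj x p := by
    intro x hx
    by_contra! hc
    exact hx ((gdeg_eq_zero T x).2 hc)
  have F0 : ∀ x w, gdeg T x ≠ 0 → gdeg T w = 0 → G.Adj x w →
      GInv G r {w} (T ⊔ edge x w) := by
    intro x w hx hw hxw
    have hx1 := F1 x w hx hw hxw
    obtain ⟨p, hp⟩ := par x hx
    have hp3 := h.leaf x (by simp) p w hp hx1 hxw hw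
    simpa using h.addC hx1 hp (by omega) hxw hw
  have F3 : ∀ x w a b, gdeg T x ≠ 0 → gdeg T w = 0 → G.Adj x w → gdeg T a = 0 → gdeg T b = 0 →
      G.Adj w a → G.Adj w b → a = b := by
    intro x w a b hx hw hxw ha hb hwa hwb
    by_contra hne
    have h1 := F0 x w hx hw hxw
    have hd := gdeg_add T hxw.ne hw
    have hwa' := hwa.ne
    have hwb' := hwb.ne
    have hxw' := hxw.ne
    have ha1 : gdeg (T ⊔ edge x w) a = 0 := by grind
    have hb1 : gdeg (T ⊔ edge x w) b = 0 := by grind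
    have h2 := h1.addB (by grind) hwa ha1 hwb hb1 hne
    have hd1 := gdeg_add (T ⊔ edge x w) hwa.ne ha1
    have hb2 : gdeg (T ⊔ edge x w ⊔ edge w a) b = 0 := by grind
    have hd2 := gdeg_add (T ⊔ edge x w ⊔ edge w a) hwb.ne hb2
    refine key (h2.drop ?_) (le_sup_left.trans le_sup_left) hxw.ne hw
    intro y hy
    rw [Set.mem_singleton_iff] at hy
    subst hy
    grind
  have hv1 := F1 v u hv hu hvu
  have h1 := F0 v u hv hu hvu
  have hA := add_adj T hvu.ne
  have hd := gdeg_add T hvu.ne hu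
  have hvu' := hvu.ne
  have hu' := (gdeg_eq_zero T u).1 hu
  -- `u` has an outside neighbour
  obtain ⟨s, hs, hus⟩ : ∃ s, gdeg T s = 0 ∧ G.Adj u s := by
    by_contra! hc
    refine key (h1.drop ?_) le_rfl hvu.ne hu
    intro y hy b w _ _ hyw hw
    rw [Set.mem_singleton_iff] at hy
    subst hy
    have := hc w
    clear key F0 F1 F2 F3 par hmax
    grind
  have hus' := hus.ne
  have hs' := (gdeg_eq_zero T s).1 hs
  have hvs : v ≠ s := by rintro rfl; exact hv hs
  have hs1 : gdeg (T ⊔ edge v u) s = 0 := by clear key F0 F1 F2 F3 par hmax; grind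
  by_cases hc : ∃ t, gdeg T t ≠ 0 ∧ G.Adj t s
  · obtain ⟨t, ht, hts⟩ := hc
    have hts' := hts.ne
    have hvt : v ≠ t := by
      rintro rfl
      exact hus' (F2 v u s hv hu hvu hs hts)
    have htu : t ≠ u := by rintro rfl; exact ht hu
    have ht1 := F1 t s ht hs hts
    obtain ⟨p, hp⟩ := par t ht
    have hp3 := h.leaf t (by simp) p s hp ht1 hts hs
    have hp3' : 3 ≤ gdeg (T ⊔ edge v u) p := by rw [hd]; omega
    have h2 := h1.addC (x := t) (v := p) (u := s) (by clear key F0 F1 F2 F3 par hmax; grind) ((hA t p).2 (Or.inl hp)) (by omega)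
      hts hs1
    have hd2 := gdeg_add (T ⊔ edge v u) hts' hs1
    refine key (h2.drop ?_) le_sup_left hvu.ne hu
    intro y hy b w _ _ hyw hw
    simp only [Set.mem_insert_iff, Set.mem_singleton_iff] at hy
    exfalso
    have hw0 : gdeg T w = 0 := by clear key F0 F1 F2 F3 par hmax; grind
    have hwu : w ≠ u := by clear key F0 F1 F2 F3 par hmax; grind
    have hws : w ≠ s := by clear key F0 F1 F2 F3 par hmax; grind
    rcases hy with rfl | rfl
    · exact hwu (F3 t y w u ht hs hts hw0 hu hyw hus.symm)
    · exact hws (F3 v y w s hv hu hvu hw0 hs hyw hus)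
  · push Not at hc
    obtain ⟨a, b, ha, hb, hau, hbu, hab⟩ :
        ∃ a b, G.Adj s a ∧ G.Adj s b ∧ a ≠ u ∧ b ≠ u ∧ a ≠ b := by
      obtain ⟨a, b, c, ha, hb, hc, hab, hac, hbc⟩ := exists_three (hdeg s)
      by_cases h1 : a = u
      · exact ⟨b, c, hb, hc, by clear key F0 F1 F2 F3 par hmax; grind, by clear key F0 F1 F2 F3 par hmax; grind, hbc⟩
      · by_cases h2 : b = u
        · exact ⟨a, c, ha, hc, by clear key F0 F1 F2 F3 par hmax; grind, by clear key F0 F1 F2 F3 par hmax; grind, hac⟩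
        · exact ⟨a, b, ha, hb, h1, h2, hab⟩
    have ha0 : gdeg T a = 0 := by
      by_contra hne; exact hc a hne ha.symm
    have hb0 : gdeg T b = 0 := by
      by_contra hne; exact hc b hne hb.symm
    have hsa := ha.ne
    have hsb := hb.ne
    obtain ⟨p, hp⟩ := par v hv
    have hp3 := h.leaf v (by simp) p u hp hv1 hvu hu
    have huniq : ∀ y, T.Adj v y → 3 ≤ gdeg T y := by
      intro y hy
      exact h.leaf v (by simp) y u hy hv1 hvu hu
    have h2 := h1.addC (x := u) (v := v) (u := s) (by clear key F0 F1 F2 F3 par hmax; grind)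
      ((hA u v).2 (by simp)) (by clear key F0 F1 F2 F3 par hmax; grind) hus hs1
    have hd2 := gdeg_add (T ⊔ edge v u) hus' hs1
    have ha2 : gdeg (T ⊔ edge v u ⊔ edge u s) a = 0 := by clear key F0 F1 F2 F3 par hmax; grind
    have hb2 : gdeg (T ⊔ edge v u ⊔ edge u s) b = 0 := by clear key F0 F1 F2 F3 par hmax; grind
    have h3 := h2.addB (by clear key F0 F1 F2 F3 par hmax; grind) ha ha2 hb hb2 hab
    have hd3 := gdeg_add (T ⊔ edge v u ⊔ edge u s) hsa ha2
    have hb3 : gdeg (T ⊔ edge v u ⊔ edge u s ⊔ edge s a) b = 0 := by clear key F0 F1 F2 F3 par hmax; grind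
    have hd4 := gdeg_add (T ⊔ edge v u ⊔ edge u s ⊔ edge s a) hsb hb3
    refine key (h3.drop ?_) (le_sup_left.trans (le_sup_left.trans le_sup_left)) hvu.ne hu
    intro y hy
    simp only [Set.mem_insert_iff, Set.mem_singleton_iff] at hy
    clear key F0 F1 F2 F3 par hmax
    grind

end aux

/-- Every finite simple connected graph with minimum degree at least 3 contains a spanning
tree `T` without three consecutive vertices of degree 2, i.e. `T` contains no path on three
vertices all of which have degree 2 in `T`. -/
theorem stmt_1 (V : Type) [Fintype V] (G : SimpleGraph V)
    (hconn : G.Connected) (hdeg : ∀ v, 3 ≤ gdeg G v) :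
    ∃ T : SimpleGraph V, T ≤ G ∧ T.IsTree ∧
      ¬∃ a b c : V, a ≠ c ∧ T.Adj a b ∧ T.Adj b c ∧
        gdeg T a = 2 ∧ gdeg T b = 2 ∧ gdeg T c = 2 := by
  classical
  obtain ⟨r⟩ := hconn.nonempty
  obtain ⟨T0, hT0, hr0⟩ := exists_start (hdeg r)
  obtain ⟨T, hle, hT⟩ := (Set.toFinite {T | GInv G r ∅ T}).exists_le_maximal hT0
  have hI : GInv G r ∅ T := hT.prop
  have hr : gdeg T r ≠ 0 := by
    rw [Ne, gdeg_eq_zero] at hr0 ⊢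
    exact fun hc => hr0 fun w hw => hc w (hle hw)
  have hall : ∀ v, gdeg T v ≠ 0 := by
    intro v
    have hstep : ∀ a b, G.Adj a b → gdeg T a ≠ 0 → gdeg T b ≠ 0 := by
      intro a b hab ha hb
      exact extend hdeg hI (fun T' h1 h2 => hT.le_of_ge h1 h2) ha hb hab
    have hw : ∀ a b, G.Walk a b → gdeg T a ≠ 0 → gdeg T b ≠ 0 := by
      intro a b p
      induction p with
      | nil => exact id
      | cons hadj _ ih => exact fun ha => ih (hstep _ _ hadj ha)
    obtain ⟨p⟩ := hconn.preconnected r v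
    exact hw r v p hr
  refine ⟨T, hI.base.le, ⟨?_, hI.base.acyc⟩, ?_⟩
  · have : Nonempty V := ⟨r⟩
    refine ⟨fun a b => ?_⟩
    exact (hI.base.reach a (hall a)).symm.trans (hI.base.reach b (hall b))
  · rintro ⟨a, b, c, hac, hab, hbc, ha, hb, hc⟩
    exact hI.run a b c hac hab hbc ha hb hc
end
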